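/- Every 1-planar graph with minimum degree 7 contains a 4-cycle x₁x₂x₃x₄ together with the chord x₁x₃ such that deg(x₁) = deg(x₃) = 7 and deg(x₂) ≤ 9, deg(x₄) ≤ 9. -/

import Mathlib

/-- A 1-planar drawing of a simple graph in the plane: vertices at distinct
points, each edge an injective continuous arc between the images of its
endpoints, arc interiors avoiding vertices, any two arcs crossing in at most
one interior point, and every edge crossing at most one other edge. -/
structure OnePlanarDrawing {V : Type*} (G : SimpleGraph V) where
  pos : V → ℝ × ℝ
  pos_inj : Function.Injective pos
  arc : G.edgeSet → ℝ → ℝ × ℝ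
  arc_cont : ∀ e, ContinuousOn (arc e) (Set.Icc 0 1)
  arc_inj : ∀ e, Set.InjOn (arc e) (Set.Icc 0 1)
  arc_ends : ∀ e : G.edgeSet, ∃ u v : V, (e : Sym2 V) = s(u, v) ∧
      arc e 0 = pos u ∧ arc e 1 = pos v
  arc_avoids : ∀ e, ∀ t ∈ Set.Ioo (0 : ℝ) 1, arc e t ∉ Set.range pos
  crossings_subsingleton : ∀ e f : G.edgeSet, e ≠ f →
      (arc e '' Set.Ioo 0 1 ∩ arc f '' Set.Ioo 0 1).Subsingleton
  at_most_one_crossing : ∀ e : G.edgeSet,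
      {f : G.edgeSet | f ≠ e ∧
        (arc e '' Set.Ioo 0 1 ∩ arc f '' Set.Ioo 0 1).Nonempty}.Subsingleton

/-- A graph is 1-planar if it admits a drawing in the plane in which every
edge crosses at most one other edge. -/
def SimpleGraph.IsOnePlanar {V : Type*} (G : SimpleGraph V) : Prop :=
  Nonempty (OnePlanarDrawing G)

namespace PermOrbit

open Equiv

variable {D : Type*}

noncomputable def numOrbits (s : Setoid D) : ℕ := Nat.card (Quotient s)

abbrev cyc (σ : Perm D) : Setoid D := Perm.SameCycle.setoid σ

lemma cyc_le_iff {σ : Perm D} {s : Setoid D} : cyc σ ≤ s ↔ ∀ x, s x (σ x) := by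
  constructor
  · intro h x
    exact h ⟨1, by simp⟩
  · rintro h x y ⟨i, rfl⟩
    induction i with
    | zero => exact s.refl _
    | succ n ih =>
      refine s.trans ih ?_
      have := h ((σ ^ (n : ℤ)) x)
      rwa [← Perm.mul_apply, ← zpow_one_add, add_comm] at this
    | pred n ih =>
      refine s.trans ih (s.symm ?_)
      have := h ((σ ^ (-(n : ℤ) - 1)) x)
      rwa [← Perm.mul_apply, ← zpow_one_add, add_sub_cancel] at this

/-- The equivalence relation obtained by gluing the classes of `a` and `b`. -/
def link (s : Setoid D) (a b : D) : Setoid D where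
  r x y := s x y ∨ (s x a ∧ s y b) ∨ (s x b ∧ s y a)
  iseqv :=
    { refl := fun x => Or.inl (s.refl x)
      symm := by
        rintro x y (h | ⟨h, k⟩ | ⟨h, k⟩)
        exacts [Or.inl (s.symm h), Or.inr (Or.inr ⟨k, h⟩), Or.inr (Or.inl ⟨k, h⟩)]
      trans := by
        rintro x y z (h | ⟨h, k⟩ | ⟨h, k⟩) (h' | ⟨h', k'⟩ | ⟨h', k'⟩)
        · exact Or.inl (s.trans h h')
        · exact Or.inr (Or.inl ⟨s.trans h h', k'⟩)
        · exact Or.inr (Or.inr ⟨s.trans h h', k'⟩)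
        · exact Or.inr (Or.inl ⟨h, s.trans (s.symm h') k⟩)
        · exact Or.inl (s.trans h (s.trans (s.symm h') (s.trans k (s.symm k'))))
        · exact Or.inl (s.trans h (s.symm k'))
        · exact Or.inr (Or.inr ⟨h, s.trans (s.symm h') k⟩)
        · exact Or.inl (s.trans h (s.symm k'))
        · exact Or.inl (s.trans h (s.trans (s.symm h') (s.trans k (s.symm k')))) }

lemma link_iff {s : Setoid D} {a b x y : D} :
    link s a b x y ↔ s x y ∨ (s x a ∧ s y b) ∨ (s x b ∧ s y a) := Iff.rfl

lemma le_link (s : Setoid D) (a b : D) : s ≤ link s a b := fun _ _ h => Or.inl h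

lemma link_self (s : Setoid D) (a b : D) : link s a b a b :=
  Or.inr (Or.inl ⟨s.refl a, s.refl b⟩)

lemma link_le_iff {s t : Setoid D} {a b : D} : link s a b ≤ t ↔ s ≤ t ∧ t a b := by
  constructor
  · intro h
    exact ⟨(le_link s a b).trans h, h (link_self s a b)⟩
  · rintro ⟨h, hab⟩ x y (k | ⟨k, k'⟩ | ⟨k, k'⟩)
    · exact h k
    · exact t.trans (h k) (t.trans hab (t.symm (h k')))
    · exact t.trans (h k) (t.trans (t.symm hab) (t.symm (h k')))

lemma link_of_rel {s : Setoid D} {a b : D} (h : s a b) : link s a b = s :=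
  le_antisymm (link_le_iff.2 ⟨le_rfl, h⟩) (le_link s a b)

lemma numOrbits_link [Finite D] {s : Setoid D} {a b : D} (h : ¬ s a b) :
    numOrbits (link s a b) + 1 = numOrbits s := by
  classical
  have key : Function.Bijective
      (fun q : {q : Quotient s // q ≠ Quotient.mk s b} =>
        (Quotient.map' (s₂ := link s a b) id (le_link s a b) q.1 : Quotient (link s a b))) := by
    constructor
    · rintro ⟨q, hq⟩ ⟨r, hr⟩ hqr
      induction q using Quotient.inductionOn with | _ x =>
      induction r using Quotient.inductionOn with | _ y =>
      have hx : ¬ s x b := fun k => hq (Quotient.sound k)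
      have hy : ¬ s y b := fun k => hr (Quotient.sound k)
      have : link s a b x y := Quotient.exact hqr
      rcases this with k | ⟨k, k'⟩ | ⟨k, k'⟩
      · exact Subtype.ext (Quotient.sound k)
      · exact (hy k').elim
      · exact (hx k).elim
    · intro q
      induction q using Quotient.inductionOn with | _ x =>
      by_cases hx : s x b
      · refine ⟨⟨Quotient.mk s a, fun k => h (Quotient.exact k)⟩, ?_⟩
        exact Quotient.sound (s := link s a b) (Or.inr (Or.inl ⟨s.refl a, hx⟩))
      · exact ⟨⟨Quotient.mk s x, fun k => hx (Quotient.exact k)⟩, rfl⟩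
  unfold numOrbits
  rw [← Nat.card_congr (Equiv.ofBijective _ key), ← Finite.card_option,
    Nat.card_congr (Equiv.optionSubtypeNe (Quotient.mk s b))]

lemma not_sameCycle_of_invariant [Finite D] {σ : Perm D} (S : Set D) (h : ∀ x ∈ S, σ x ∈ S)
    {a b : D} (ha : a ∈ S) (hb : b ∉ S) : ¬ σ.SameCycle a b := by
  intro hab
  obtain ⟨i, rfl⟩ := hab.exists_nat_pow_eq
  apply hb
  clear hb hab
  induction i with
  | zero => simpa
  | succ n ih => rw [pow_succ', Perm.mul_apply]; exact h _ ih

variable [DecidableEq D]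

lemma link_cyc_swap (σ : Perm D) (a b : D) :
    link (cyc (swap a b * σ)) a b = link (cyc σ) a b := by
  have aux : ∀ σ : Perm D, link (cyc σ) a b ≤ link (cyc (swap a b * σ)) a b := by
    intro σ
    refine link_le_iff.2 ⟨cyc_le_iff.2 fun x => ?_, link_self _ _ _⟩
    set t := link (cyc (swap a b * σ)) a b with ht
    have h1 : t x ((swap a b * σ) x) := le_link _ _ _ (cyc_le_iff.1 le_rfl x)
    refine t.trans h1 ?_
    rw [Perm.mul_apply]
    by_cases ha : σ x = a
    · rw [ha, swap_apply_left]; exact t.symm (link_self _ _ _)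
    by_cases hb : σ x = b
    · rw [hb, swap_apply_right]; exact link_self _ _ _
    · rw [swap_apply_of_ne_of_ne ha hb]
  refine le_antisymm ?_ (aux σ)
  simpa [← mul_assoc] using aux (swap a b * σ)

lemma iterate_swap_mul {σ : Perm D} {a b : D} (j : ℕ)
    (h : ∀ i, 0 < i → i ≤ j → (σ ^ i) a ≠ a ∧ (σ ^ i) a ≠ b) :
    ((swap a b * σ) ^ j) a = (σ ^ j) a := by
  induction j with
  | zero => simp
  | succ j ih =>
    have := h (j + 1) (by omega) le_rfl
    rw [pow_succ', Perm.mul_apply, ih fun i hi hij => h i hi (by omega), Perm.mul_apply]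
    rw [pow_succ', Perm.mul_apply] at this ⊢
    exact swap_apply_of_ne_of_ne this.1 this.2

lemma not_sameCycle_swap [Finite D] {σ : Perm D} {a b : D} (hab : a ≠ b) (h : σ.SameCycle a b) :
    ¬ (swap a b * σ).SameCycle a b := by
  classical
  have hex := h.exists_nat_pow_eq
  let k := Nat.find hex
  have hk : (σ ^ k) a = b := Nat.find_spec hex
  have hmin : ∀ i < k, (σ ^ i) a ≠ b := fun i hi => Nat.find_min hex hi
  have hk0 : 0 < k := by
    rcases Nat.eq_zero_or_pos k with h0 | h0
    · rw [h0] at hk; exact (hab hk).elim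
    · exact h0
  have hne : ∀ i, 0 < i → i < k → (σ ^ i) a ≠ a := by
    intro i hi hik heq
    apply hmin (k - i) (by omega)
    rw [← hk]
    conv_rhs => rw [show k = (k - i) + i by omega, pow_add, Perm.mul_apply, heq]
  apply not_sameCycle_of_invariant {x | ∃ j < k, (σ ^ j) a = x}
  · rintro _ ⟨j, hj, rfl⟩
    by_cases hjk : j + 1 = k
    · refine ⟨0, hk0, ?_⟩
      rw [Perm.mul_apply, ← Perm.mul_apply σ, ← pow_succ', hjk, hk]; simp
    · refine ⟨j + 1, by omega, ?_⟩
      rw [Perm.mul_apply, ← Perm.mul_apply σ, ← pow_succ', swap_apply_of_ne_of_ne]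
      · exact hne _ (by omega) (by omega)
      · exact hmin _ (by omega)
  · exact ⟨0, hk0, by simp⟩
  · rintro ⟨j, hj, hj'⟩; exact hmin j hj hj'

lemma sameCycle_swap [Finite D] {σ : Perm D} {a b : D} (h : ¬ σ.SameCycle a b) :
    (swap a b * σ).SameCycle a b := by
  classical
  have hex : ∃ k, 0 < k ∧ (σ ^ k) a = a := ⟨orderOf σ, orderOf_pos σ, by simp [pow_orderOf_eq_one]⟩
  let k := Nat.find hex
  obtain ⟨hk0, hk⟩ : 0 < k ∧ (σ ^ k) a = a := Nat.find_spec hex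
  have hmin : ∀ i < k, 0 < i → (σ ^ i) a ≠ a := fun i hi h0 h1 => Nat.find_min hex hi ⟨h0, h1⟩
  have hb : ∀ i, (σ ^ i) a ≠ b := fun i hi => h ⟨i, by simpa using hi⟩
  refine ⟨k, ?_⟩
  obtain ⟨j, hj⟩ : ∃ j, k = j + 1 := ⟨k - 1, by omega⟩
  rw [zpow_natCast, hj, pow_succ', Perm.mul_apply,
    iterate_swap_mul j (fun i hi hij => ⟨hmin i (by omega) hi, hb i⟩), Perm.mul_apply,
    ← Perm.mul_apply σ, ← pow_succ', ← hj, hk, swap_apply_left]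

end PermOrbit

namespace PermOrbit

open Equiv

variable {D : Type*}

lemma numOrbits_bot : numOrbits (⊥ : Setoid D) = Nat.card D := by
  refine (Nat.card_congr (Equiv.ofBijective (Quotient.mk (⊥ : Setoid D)) ⟨?_, ?_⟩)).symm
  · intro x y h; exact Quotient.exact h
  · exact Quotient.mk_surjective

lemma cyc_one : cyc (1 : Perm D) = ⊥ := by
  refine le_antisymm (cyc_le_iff.2 fun x => ?_) bot_le
  exact Setoid.refl' _ _

lemma cyc_mul_le (σ α : Perm D) : cyc (σ * α) ≤ cyc σ ⊔ cyc α := by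
  refine cyc_le_iff.2 fun x => ?_
  have h1 : (cyc σ ⊔ cyc α) x (α x) := (le_sup_right : cyc α ≤ _) (cyc_le_iff.1 le_rfl x)
  have h2 : (cyc σ ⊔ cyc α) (α x) (σ (α x)) :=
    (le_sup_left : cyc σ ≤ _) (cyc_le_iff.1 le_rfl (α x))
  exact Setoid.trans' _ h1 h2

lemma card_le_numOrbits [Finite D] {β : Type*} {σ : Perm D} (f : D → β)
    (hf : Function.Surjective f) (h : ∀ x, f (σ x) = f x) : Nat.card β ≤ numOrbits (cyc σ) := by
  have h' : cyc σ ≤ Setoid.ker f := cyc_le_iff.2 fun x => (h x).symm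
  refine Nat.card_le_card_of_surjective (Quotient.lift f fun _ _ k => h' k) fun b => ?_
  obtain ⟨x, rfl⟩ := hf b
  exact ⟨Quotient.mk _ x, rfl⟩

/-- For an involution `α`, twice the total genus of the combinatorial map `(σ, α)`. -/
noncomputable def eulerDefect (σ α : Perm D) : ℤ :=
  Nat.card D + 2 * numOrbits (cyc σ ⊔ cyc α) - numOrbits (cyc σ) - numOrbits (cyc α)
    - numOrbits (cyc (σ * α))

lemma link_sup (s t : Setoid D) (a b : D) : link (s ⊔ t) a b = link s a b ⊔ t := by
  refine le_antisymm (link_le_iff.2 ⟨sup_le_sup_right (le_link s a b) t, ?_⟩)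
    (sup_le (link_le_iff.2 ⟨?_, link_self _ _ _⟩) ?_)
  · exact (le_sup_left : link s a b ≤ _) (link_self s a b)
  · exact le_sup_left.trans (le_link _ _ _)
  · exact le_sup_right.trans (le_link _ _ _)

lemma sameCycle_isolate [DecidableEq D] {σ : Perm D} {a x y : D} (hx : x ≠ a) (hy : y ≠ a) :
    (swap a (σ a) * σ).SameCycle x y ↔ σ.SameCycle x y := by
  have hl : link (cyc (swap a (σ a) * σ)) a (σ a) = cyc σ := by
    rw [link_cyc_swap, link_of_rel]
    exact ⟨1, by simp⟩
  have hfix : (swap a (σ a) * σ) a = a := by simp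
  have hnot : ∀ z, z ≠ a → ¬ (swap a (σ a) * σ).SameCycle z a := by
    intro z hz hza
    exact hz (Perm.SameCycle.eq_of_right hza hfix)
  constructor
  · intro h
    have : cyc σ x y := by rw [← hl]; exact le_link _ _ _ h
    exact this
  · intro h
    have : link (cyc (swap a (σ a) * σ)) a (σ a) x y := by rw [hl]; exact h
    rcases this with k | ⟨k, -⟩ | ⟨-, k⟩
    · exact k
    · exact (hnot x hx k).elim
    · exact (hnot y hy k).elim

section DecEq
variable [DecidableEq D] [Finite D]

lemma numOrbits_swap_of_sameCycle {σ : Perm D} {a b : D} (hab : a ≠ b) (h : σ.SameCycle a b) :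
    numOrbits (cyc (swap a b * σ)) = numOrbits (cyc σ) + 1 := by
  have h1 := numOrbits_link (s := cyc (swap a b * σ)) (a := a) (b := b)
    (not_sameCycle_swap hab h)
  rw [link_cyc_swap, link_of_rel (s := cyc σ) h] at h1
  exact h1.symm

lemma numOrbits_swap_of_not_sameCycle {σ : Perm D} {a b : D} (h : ¬ σ.SameCycle a b) :
    numOrbits (cyc (swap a b * σ)) + 1 = numOrbits (cyc σ) := by
  have h1 := numOrbits_link (s := cyc σ) (a := a) (b := b) h
  rw [← link_cyc_swap, link_of_rel (s := cyc (swap a b * σ)) (sameCycle_swap h)] at h1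
  exact h1

lemma eulerDefect_split {σ : Perm D} {a b : D} (α : Perm D) (h : σ.SameCycle a b) :
    eulerDefect (swap a b * σ) α ≤ eulerDefect σ α := by
  by_cases hab : a = b
  · subst hab; simp [Perm.mul_def]
  have hV := numOrbits_swap_of_sameCycle hab h
  have hC : link (cyc (swap a b * σ) ⊔ cyc α) a b = cyc σ ⊔ cyc α := by
    rw [link_sup, link_cyc_swap, link_of_rel (s := cyc σ) h]
  unfold eulerDefect
  rw [mul_assoc]
  by_cases hcon : (cyc (swap a b * σ) ⊔ cyc α) a b
  · rw [link_of_rel hcon] at hC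
    rw [hC]
    by_cases hF : (σ * α).SameCycle a b
    · have := numOrbits_swap_of_sameCycle hab hF
      omega
    · have := numOrbits_swap_of_not_sameCycle hF
      omega
  · have h1 := numOrbits_link hcon
    rw [hC] at h1
    have hF : (σ * α).SameCycle a b := by
      by_contra hF
      have h2 := sameCycle_swap hF
      rw [← mul_assoc] at h2
      exact hcon (cyc_mul_le _ _ h2)
    have := numOrbits_swap_of_sameCycle hab hF
    omega

lemma eulerDefect_nonneg (σ α : Perm D) : 0 ≤ eulerDefect σ α := by
  cases nonempty_fintype D
  induction hn : σ.support.card using Nat.strong_induction_on generalizing σ with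
  | _ n ih =>
    by_cases hσ : ∃ x, σ x ≠ x
    · obtain ⟨x, hx⟩ := hσ
      have h1 := Perm.card_support_swap_mul hx
      have h2 := ih _ (hn ▸ h1) (swap x (σ x) * σ) rfl
      exact h2.trans (eulerDefect_split α ⟨1, by simp⟩)
    · push Not at hσ
      obtain rfl : σ = 1 := Equiv.ext hσ
      unfold eulerDefect
      rw [cyc_one, bot_sup_eq, one_mul, numOrbits_bot]
      omega

lemma cyc_merge {σ : Perm D} {a b : D} (h : ¬ σ.SameCycle a b) :
    cyc (swap a b * σ) = link (cyc σ) a b := by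
  rw [← link_cyc_swap, link_of_rel (s := cyc (swap a b * σ)) (sameCycle_swap h)]

lemma eulerDefect_merge {σ α : Perm D} {a : D} (hα : α (α a) = a) (h : ¬ σ.SameCycle (α a) (σ a)) :
    eulerDefect (swap (α a) (σ a) * σ) α ≤ eulerDefect σ α := by
  have hne : α a ≠ σ a := by
    intro k; rw [k] at h; exact h (Perm.SameCycle.refl _ _)
  have hV := numOrbits_swap_of_not_sameCycle h
  have hF : (σ * α).SameCycle (α a) (σ a) := ⟨1, by simp [hα]⟩
  have hF' := numOrbits_swap_of_sameCycle hne hF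
  have hC : cyc (swap (α a) (σ a) * σ) ⊔ cyc α = cyc σ ⊔ cyc α := by
    rw [cyc_merge h, ← link_sup, link_of_rel]
    have h1 : (cyc σ ⊔ cyc α) (α a) a :=
      Setoid.symm' _ ((le_sup_right : cyc α ≤ _) (cyc_le_iff.1 le_rfl a))
    exact Setoid.trans' _ h1 ((le_sup_left : cyc σ ≤ _) (cyc_le_iff.1 le_rfl a))
  unfold eulerDefect
  rw [hC, mul_assoc]
  omega

lemma exists_isolate (σ α : Perm D) (T : Finset D) :
    ∃ σ' : Perm D, (∀ a ∈ T, σ' a = a) ∧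
      (∀ x ∉ T, ∀ y ∉ T, σ'.SameCycle x y ↔ σ.SameCycle x y) ∧
      eulerDefect σ' α ≤ eulerDefect σ α := by
  induction T using Finset.induction_on with
  | empty => exact ⟨σ, by simp, by simp, le_rfl⟩
  | insert a T ha ih =>
    obtain ⟨σ', h1, h2, h3⟩ := ih
    refine ⟨swap a (σ' a) * σ', ?_, ?_, (eulerDefect_split α ⟨1, by simp⟩).trans h3⟩
    · intro x hx
      rcases Finset.mem_insert.1 hx with rfl | hx
      · simp
      · have hxa : x ≠ a := fun h => ha (h ▸ hx)
        rw [Perm.mul_apply, h1 x hx, swap_apply_of_ne_of_ne hxa]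
        intro h
        rw [← h1 x hx] at h
        exact hxa (σ'.injective h)
    · intro x hx y hy
      simp only [Finset.mem_insert, not_or] at hx hy
      rw [sameCycle_isolate hx.1 hy.1, h2 x hx.2 y hy.2]

end DecEq

section Restrict
variable {E : Type*}

lemma numOrbits_add_compl [Finite D] {E' : Type*} (s : Setoid D) (f : E → D) (g : E' → D)
    (hfg : ∀ x, (x ∈ Set.range f ∨ x ∈ Set.range g))
    (hs : ∀ x y, ¬ s (f x) (g y)) :
    numOrbits s = numOrbits (s.comap f) + numOrbits (s.comap g) := by
  have hf : Function.Injective (Quotient.map' (s₁ := s.comap f) (s₂ := s) f fun _ _ h => h) := by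
    intro x y h
    induction x using Quotient.inductionOn with | _ x =>
    induction y using Quotient.inductionOn with | _ y =>
    have k : s (f x) (f y) := Quotient.exact h
    exact Quotient.sound (s := s.comap f) k
  have hg : Function.Injective (Quotient.map' (s₁ := s.comap g) (s₂ := s) g fun _ _ h => h) := by
    intro x y h
    induction x using Quotient.inductionOn with | _ x =>
    induction y using Quotient.inductionOn with | _ y =>
    have k : s (g x) (g y) := Quotient.exact h
    exact Quotient.sound (s := s.comap g) k
  have := Finite.of_injective _ hf
  have := Finite.of_injective _ hg
  unfold numOrbits
  rw [← Nat.card_sum]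
  symm
  refine Nat.card_congr (Equiv.ofBijective (Sum.elim _ _) ⟨hf.sumElim hg ?_, ?_⟩)
  · intro x y h
    induction x using Quotient.inductionOn with | _ x =>
    induction y using Quotient.inductionOn with | _ y =>
    exact hs x y (Quotient.exact h)
  · intro z
    induction z using Quotient.inductionOn with | _ z =>
    rcases hfg z with ⟨x, rfl⟩ | ⟨x, rfl⟩
    · exact ⟨Sum.inl (Quotient.mk _ x), rfl⟩
    · exact ⟨Sum.inr (Quotient.mk _ x), rfl⟩

lemma cyc_comap {σ : Perm D} {σ' : Perm E} {f : E → D} (hf : Function.Injective f)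
    (h : ∀ x, f (σ' x) = σ (f x)) : (cyc σ).comap f = cyc σ' := by
  have hpow : ∀ (n : ℕ) x, f ((σ' ^ n) x) = (σ ^ n) (f x) := by
    intro n
    induction n with
    | zero => simp
    | succ n ih => intro x; rw [pow_succ, Perm.mul_apply, ih, h, pow_succ, Perm.mul_apply]
  have hzpow : ∀ (n : ℤ) x, f ((σ' ^ n) x) = (σ ^ n) (f x) := by
    intro n x
    obtain ⟨n, rfl | rfl⟩ := n.eq_nat_or_neg
    · simpa using hpow n x
    · rw [zpow_neg, zpow_neg, zpow_natCast, zpow_natCast, Perm.eq_inv_iff_eq, ← hpow]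
      simp
  ext x y
  constructor
  · rintro ⟨i, hi⟩
    exact ⟨i, hf (by rw [hzpow, hi])⟩
  · rintro ⟨i, hi⟩
    exact ⟨i, by rw [← hzpow, hi]⟩

lemma comap_sup {s t : Setoid D} {f : E → D} (hf : Function.Injective f)
    (hs : ∀ x y, s x y → (x ∈ Set.range f ↔ y ∈ Set.range f))
    (ht : ∀ x y, t x y → (x ∈ Set.range f ↔ y ∈ Set.range f)) :
    (s ⊔ t).comap f = s.comap f ⊔ t.comap f := by
  set w := s.comap f ⊔ t.comap f with hw
  refine le_antisymm ?_ (sup_le (fun _ _ h => (le_sup_left : s ≤ s ⊔ t) h)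
    (fun _ _ h => (le_sup_right : t ≤ s ⊔ t) h))
  let u : Setoid D :=
    { r := fun x y => (x ∉ Set.range f ∧ y ∉ Set.range f) ∨ ∃ x' y', f x' = x ∧ f y' = y ∧ w x' y'
      iseqv :=
        { refl := fun x => by
            by_cases hx : x ∈ Set.range f
            · obtain ⟨x', hx'⟩ := hx
              exact Or.inr ⟨x', x', hx', hx', w.refl _⟩
            · exact Or.inl ⟨hx, hx⟩
          symm := by
            rintro x y (⟨h, k⟩ | ⟨x', y', h, k, l⟩)
            · exact Or.inl ⟨k, h⟩
            · exact Or.inr ⟨y', x', k, h, w.symm l⟩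
          trans := by
            rintro x y z (⟨h, k⟩ | ⟨x', y', h, k, l⟩) (⟨h', k'⟩ | ⟨y'', z', h', k', l'⟩)
            · exact Or.inl ⟨h, k'⟩
            · exact (k ⟨_, h'⟩).elim
            · exact (h' ⟨_, k⟩).elim
            · have : y' = y'' := hf (k.trans h'.symm)
              subst this
              exact Or.inr ⟨x', z', h, k', w.trans l l'⟩ } }
  have hsub : ∀ r : Setoid D, r.comap f ≤ w →
      (∀ x y, r x y → (x ∈ Set.range f ↔ y ∈ Set.range f)) → r ≤ u := by
    intro r hr hsat x y hxy
    by_cases hx : x ∈ Set.range f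
    · obtain ⟨y', rfl⟩ := (hsat x y hxy).1 hx
      obtain ⟨x', rfl⟩ := hx
      exact Or.inr ⟨x', y', rfl, rfl, hr hxy⟩
    · exact Or.inl ⟨hx, fun hy => hx ((hsat x y hxy).2 hy)⟩
  have hle : s ⊔ t ≤ u := sup_le (hsub s le_sup_left hs) (hsub t le_sup_right ht)
  intro x y hxy
  rcases hle hxy with ⟨h, -⟩ | ⟨x', y', h, k, l⟩
  · exact (h ⟨x, rfl⟩).elim
  · rw [← hf h, ← hf k]; exact l

lemma exists_perm_restrict [Finite E] {σ : Perm D} {f : E → D} (hf : Function.Injective f)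
    (h : ∀ x, ∃ y, f y = σ (f x)) : ∃ σ' : Perm E, ∀ x, f (σ' x) = σ (f x) := by
  choose g hg using h
  have hinj : Function.Injective g := by
    intro x y hxy
    apply hf
    apply σ.injective
    rw [← hg, ← hg, hxy]
  exact ⟨Equiv.ofBijective g (Finite.injective_iff_bijective.1 hinj), hg⟩

lemma range_iff_of_cyc [Finite E] {σ : Perm D} {σ' : Perm E} {f : E → D}
    (h : ∀ x, f (σ' x) = σ (f x)) (x y : D) (hxy : cyc σ x y) :
    x ∈ Set.range f ↔ y ∈ Set.range f := by
  have : cyc σ ≤ Setoid.ker (fun x => x ∈ Set.range f) := by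
    refine cyc_le_iff.2 fun x => ?_
    rw [Setoid.ker_def]
    refine propext ⟨?_, ?_⟩
    · rintro ⟨y, rfl⟩; exact ⟨_, h y⟩
    · rintro ⟨y, hy⟩
      refine ⟨σ'⁻¹ y, σ.injective ?_⟩
      rw [← h, ← hy]; simp
  exact iff_of_eq (this hxy)

lemma eulerDefect_restrict [Finite D] [Finite E] {σ α : Perm D} {σ' α' : Perm E} {f : E → D}
    (hf : Function.Injective f) (hσ : ∀ x, f (σ' x) = σ (f x)) (hα : ∀ x, f (α' x) = α (f x)) :
    eulerDefect σ' α' ≤ eulerDefect σ α := by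
  classical
  let g : {x // x ∉ Set.range f} → D := Subtype.val
  have hg : Function.Injective g := Subtype.val_injective
  have hσα : ∀ x, f ((σ' * α') x) = (σ * α) (f x) := fun x => by simp [hσ, hα]
  have hgen : ∀ {τ : Perm D} {τ' : Perm E}, (∀ x, f (τ' x) = τ (f x)) →
      ∃ τ'' : Perm {x // x ∉ Set.range f}, ∀ x, g (τ'' x) = τ (g x) := by
    intro τ τ' h
    apply exists_perm_restrict hg
    rintro ⟨x, hx⟩
    refine ⟨⟨τ x, fun k => hx ((range_iff_of_cyc h x (τ x) (cyc_le_iff.1 le_rfl x)).2 k)⟩, rfl⟩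
  obtain ⟨σ'', hσ''⟩ := hgen hσ
  obtain ⟨α'', hα''⟩ := hgen hα
  have hσα'' : ∀ x, g ((σ'' * α'') x) = (σ * α) (g x) := fun x => by simp [hσ'', hα'']
  have hcov : ∀ x, x ∈ Set.range f ∨ x ∈ Set.range g := by
    intro x
    by_cases hx : x ∈ Set.range f
    · exact Or.inl hx
    · exact Or.inr ⟨⟨x, hx⟩, rfl⟩
  have hsum : ∀ {τ : Perm D} {τ' : Perm E} {τ'' : Perm {x // x ∉ Set.range f}},
      (∀ x, f (τ' x) = τ (f x)) → (∀ x, g (τ'' x) = τ (g x)) →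
      numOrbits (cyc τ) = numOrbits (cyc τ') + numOrbits (cyc τ'') := by
    intro τ τ' τ'' h1 h2
    rw [← cyc_comap hf h1, ← cyc_comap hg h2]
    apply numOrbits_add_compl _ _ _ hcov
    intro x y hxy
    exact y.2 ((range_iff_of_cyc h1 _ _ hxy).1 ⟨x, rfl⟩)
  have hC : numOrbits (cyc σ ⊔ cyc α) = numOrbits (cyc σ' ⊔ cyc α') + numOrbits (cyc σ'' ⊔ cyc α'') := by
    rw [← cyc_comap hf hσ, ← cyc_comap hg hσ'', ← cyc_comap hf hα, ← cyc_comap hg hα'',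
      ← comap_sup hf (range_iff_of_cyc hσ) (range_iff_of_cyc hα),
      ← comap_sup hg (range_iff_of_cyc hσ'') (range_iff_of_cyc hα'')]
    apply numOrbits_add_compl _ _ _ hcov
    intro x y hxy
    have : cyc σ ⊔ cyc α ≤ Setoid.ker (fun x => x ∈ Set.range f) :=
      sup_le (fun a b h => propext (range_iff_of_cyc hσ a b h))
        (fun a b h => propext (range_iff_of_cyc hα a b h))
    exact y.2 ((iff_of_eq (this hxy)).1 ⟨x, rfl⟩)
  have hD : Nat.card D = Nat.card E + Nat.card {x // x ∉ Set.range f} := by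
    rw [← numOrbits_bot, numOrbits_add_compl ⊥ f g hcov, ← numOrbits_bot, ← numOrbits_bot]
    · congr 2
      · ext x y; exact hf.eq_iff
      · ext x y; exact hg.eq_iff
    · rintro x ⟨y, hy⟩ h
      exact hy ⟨x, h⟩
  have := eulerDefect_nonneg σ'' α''
  have h1 := hsum hσ hσ''
  have h2 := hsum hα hα''
  have h3 := hsum hσα hσα''
  unfold eulerDefect at this ⊢
  omega

end Restrict

/-- The multigraph with darts `D`, dart reversal `α` and dart tails `tail` has a spherical
rotation system. -/
def IsSpherical {W : Type*} (α : Perm D) (tail : D → W) : Prop :=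
  ∃ σ : Perm D, (∀ a b, σ.SameCycle a b ↔ tail a = tail b) ∧ eulerDefect σ α ≤ 0

namespace IsSpherical
variable {W : Type*} [Finite D] {α : Perm D} {tail : D → W}

lemma contract [DecidableEq W] (h : IsSpherical α tail) {a : D} (hα : α (α a) = a)
    (ha : tail a ≠ tail (α a)) :
    IsSpherical α (fun d => if tail d = tail (α a) then tail a else tail d) := by
  classical
  obtain ⟨σ, h1, h2⟩ := h
  have hn : ¬ σ.SameCycle (α a) (σ a) := by
    rw [h1]
    intro k
    apply ha
    rw [k, ← h1]
    exact ⟨1, by simp⟩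
  refine ⟨swap (α a) (σ a) * σ, fun x y => ?_, (eulerDefect_merge hα hn).trans h2⟩
  have h3 : tail (σ a) = tail a := by rw [← h1]; exact ⟨-1, by simp⟩
  have h4 : (swap (α a) (σ a) * σ).SameCycle x y ↔ link (cyc σ) (α a) (σ a) x y := by
    rw [← cyc_merge hn]; rfl
  have h5 : ∀ x y, cyc σ x y ↔ tail x = tail y := h1
  rw [h4, link_iff, h5, h5, h5, h5, h5, h3]
  dsimp only
  split_ifs with k1 k2 k2 <;> grind

lemma restrict {E : Type*} (h : IsSpherical α tail) (α' : Perm E) {rep : E → D}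
    (hrep : Function.Injective rep) (hα : ∀ x, rep (α' x) = α (rep x)) :
    IsSpherical α' (tail ∘ rep) := by
  classical
  cases nonempty_fintype D
  have := Finite.of_injective _ hrep
  obtain ⟨σ, h1, h2⟩ := h
  obtain ⟨σ', k1, k2, k3⟩ := exists_isolate σ α {x | x ∉ Set.range rep}
  simp only [Finset.mem_filter, Finset.mem_univ, true_and, not_not] at k1 k2
  obtain ⟨σ'', h'⟩ := exists_perm_restrict (σ := σ') hrep (by
    intro x
    by_contra hcon
    have h3 := k1 (σ' (rep x)) hcon
    have h4 := σ'.injective h3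
    exact hcon ⟨x, h4.symm⟩)
  refine ⟨σ'', fun a b => ?_, (eulerDefect_restrict hrep h' hα).trans (k3.trans h2)⟩
  have : cyc σ'' a b ↔ cyc σ' (rep a) (rep b) := by
    rw [← cyc_comap hrep h', Setoid.comap_rel]
  exact this.trans ((k2 _ ⟨a, rfl⟩ _ ⟨b, rfl⟩).trans (h1 _ _))

lemma contract_finset {ι : Type*} (h : IsSpherical α tail) (hα : ∀ a, α (α a) = a) (C : ι → Set W)
    (hC : ∀ i j x, x ∈ C i → x ∈ C j → i = j) (T : Finset D)
    (hT : ∀ d ∈ T, ∃ i, tail d ∈ C i ∧ tail (α d) ∈ C i) :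
    ∃ m : W → W, IsSpherical α (m ∘ tail) ∧ (∀ d ∈ T, m (tail d) = m (tail (α d))) ∧
      ∀ x y, m x = m y → x = y ∨ ∃ i, x ∈ C i ∧ y ∈ C i := by
  classical
  induction T using Finset.induction_on with
  | empty => exact ⟨id, h, by simp, fun x y h => Or.inl h⟩
  | insert a T ha ih =>
    obtain ⟨m, h1, h2, h3⟩ := ih fun d hd => hT d (Finset.mem_insert_of_mem hd)
    obtain ⟨i, hi, hi'⟩ := hT a (Finset.mem_insert_self _ _)
    by_cases hm : m (tail a) = m (tail (α a))
    · refine ⟨m, h1, fun d hd => ?_, h3⟩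
      rcases Finset.mem_insert.1 hd with rfl | hd
      exacts [hm, h2 d hd]
    · refine ⟨fun x => if m x = m (tail (α a)) then m (tail a) else m x,
        h1.contract (hα a) hm, fun d hd => ?_, ?_⟩
      · rcases Finset.mem_insert.1 hd with rfl | hd
        · simp [hm]
        · simp [h2 d hd]
      · intro x y hxy
        have key : ∀ x y, m x = m (tail (α a)) → m y = m (tail a) → ∃ i, x ∈ C i ∧ y ∈ C i := by
          intro x y hx hy
          refine ⟨i, ?_, ?_⟩
          · rcases h3 _ _ hx with rfl | ⟨j, hj, hj'⟩
            · exact hi'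
            · rw [hC i j _ hi' hj']; exact hj
          · rcases h3 _ _ hy with rfl | ⟨j, hj, hj'⟩
            · exact hi
            · rw [hC i j _ hi hj']; exact hj
        dsimp only at hxy
        split_ifs at hxy with k1 k2 k2
        · exact h3 _ _ (k1.trans k2.symm)
        · exact Or.inr (key x y k1 hxy.symm)
        · obtain ⟨j, hj, hj'⟩ := key y x k2 hxy
          exact Or.inr ⟨j, hj', hj⟩
        · exact h3 _ _ hxy

end IsSpherical

/-- `C` is connected with respect to the relation `R`. -/
def ConnIn {W : Type*} (R : W → W → Prop) (C : Set W) : Prop :=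
  ∀ x ∈ C, ∀ y ∈ C, Relation.ReflTransGen (fun x y => R x y ∧ x ∈ C ∧ y ∈ C) x y

/-- Spherical multigraphs are closed under taking minors. -/
lemma IsSpherical.minor {W W' E : Type*} [Finite D] {α : Perm D} {tail : D → W}
    (h : IsSpherical α tail) (hα : ∀ a, α (α a) = a) {α' : Perm E} {tail' : E → W'}
    (C : W' → Set W) (hC : ∀ i j x, x ∈ C i → x ∈ C j → i = j)
    (hconn : ∀ i, ConnIn (fun x y => ∃ d, tail d = x ∧ tail (α d) = y) (C i))
    {rep : E → D} (hrep : Function.Injective rep) (hrα : ∀ x, rep (α' x) = α (rep x))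
    (hmem : ∀ x, tail (rep x) ∈ C (tail' x)) : IsSpherical α' tail' := by
  classical
  cases nonempty_fintype D
  obtain ⟨m, h1, h2, h3⟩ := h.contract_finset hα C hC
    {d | ∃ i, tail d ∈ C i ∧ tail (α d) ∈ C i} (by simp)
  obtain ⟨σ, k1, k2⟩ := h1.restrict α' hrep hrα
  refine ⟨σ, fun a b => (k1 a b).trans ⟨fun k => ?_, fun k => ?_⟩, k2⟩
  · rcases h3 _ _ k with k | ⟨i, hi, hi'⟩
    · exact hC _ _ _ (hmem a) (k ▸ hmem b)
    · rw [hC _ _ _ (hmem a) hi, hC _ _ _ (hmem b) hi']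
  · have h4 := hconn _ _ (hmem a) _ (k ▸ hmem b)
    simp only [Function.comp]
    generalize tail (rep a) = x at h4
    generalize tail (rep b) = y at h4
    induction h4 with
    | refl => rfl
    | tail _ h5 ih =>
      rw [ih]
      obtain ⟨⟨d, rfl, rfl⟩, h6, h7⟩ := h5
      apply h2
      simp only [Finset.mem_filter, Finset.mem_univ, true_and]
      exact ⟨_, h6, h7⟩

end PermOrbit

namespace PermOrbit

open Equiv

/-- The darts of the square grid with `(m + 1) ^ 2` vertices; the last coordinate is the direction
(east, north, west, south). Darts that would leave the grid are loose ends. -/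
abbrev GridDart (m : ℕ) := (Fin (m + 1) × Fin (m + 1)) × Fin 4

namespace Grid
variable {m : ℕ}

def rot (m : ℕ) : Perm (GridDart m) := Equiv.prodCongr (Equiv.refl _) (Equiv.addRight 1)

def flipFun : GridDart m → GridDart m
  | ((i, j), 0) => if h : i.1 + 1 < m + 1 then ((⟨i.1 + 1, h⟩, j), 2) else ((i, j), 0)
  | ((i, j), 1) => if h : j.1 + 1 < m + 1 then ((i, ⟨j.1 + 1, h⟩), 3) else ((i, j), 1)
  | ((i, j), 2) => if 0 < i.1 then ((⟨i.1 - 1, by omega⟩, j), 0) else ((i, j), 2)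
  | ((i, j), 3) => if 0 < j.1 then ((i, ⟨j.1 - 1, by omega⟩), 1) else ((i, j), 3)

lemma flipFun_flipFun (d : GridDart m) : flipFun (flipFun d) = d := by
  obtain ⟨⟨i, j⟩, k⟩ := d
  fin_cases k <;> simp only [flipFun, Fin.zero_eta, Fin.mk_one, Fin.reduceFinMk] <;> split_ifs <;>
    simp only [*, dite_false, if_false] <;> grind

def flip (m : ℕ) : Perm (GridDart m) := Function.Involutive.toPerm flipFun flipFun_flipFun

lemma flip_flip (d : GridDart m) : flip m (flip m d) = d := flipFun_flipFun d

lemma flip_apply (d : GridDart m) : flip m d = flipFun d := rfl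

def edge : GridDart m → (Fin (m + 2) × Fin (m + 1)) ⊕ (Fin (m + 2) × Fin (m + 1))
  | ((i, j), 0) => Sum.inl (i.succ, j)
  | ((i, j), 1) => Sum.inr (j.succ, i)
  | ((i, j), 2) => Sum.inl (i.castSucc, j)
  | ((i, j), 3) => Sum.inr (j.castSucc, i)

def mkCell (m p q : ℕ) : Option (Fin m × Fin m) :=
  if h : (0 < p ∧ p ≤ m) ∧ (0 < q ∧ q ≤ m) then
    some (⟨p - 1, by omega⟩, ⟨q - 1, by omega⟩) else none

def cell : GridDart m → Option (Fin m × Fin m)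
  | ((i, j), 0) => mkCell m (i + 1) j
  | ((i, j), 1) => mkCell m (i + 1) (j + 1)
  | ((i, j), 2) => mkCell m i (j + 1)
  | ((i, j), 3) => mkCell m i j

lemma edge_flip (d : GridDart m) : edge (flip m d) = edge d := by
  obtain ⟨⟨i, j⟩, k⟩ := d
  rw [flip_apply]
  fin_cases k <;> simp only [flipFun, Fin.zero_eta, Fin.mk_one, Fin.reduceFinMk] <;> split_ifs <;>
    simp [edge, Fin.ext_iff] <;> omega

lemma cell_rot_flip (d : GridDart m) : cell ((rot m * flip m) d) = cell d := by
  obtain ⟨⟨i, j⟩, k⟩ := d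
  rw [Perm.mul_apply, flip_apply]
  fin_cases k <;> simp only [flipFun, Fin.zero_eta, Fin.mk_one, Fin.reduceFinMk] <;> split_ifs <;>
    simp [cell, rot, mkCell] <;> grind

lemma sameCycle_rot (a b : GridDart m) : (rot m).SameCycle a b ↔ a.1 = b.1 := by
  constructor
  · intro h
    have : cyc (rot m) ≤ Setoid.ker Prod.fst := cyc_le_iff.2 fun x => rfl
    exact this h
  · have key : ∀ (v : Fin (m + 1) × Fin (m + 1)) (k : Fin 4),
        (rot m).SameCycle (v, 0) (v, k) := by
      intro v k
      fin_cases k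
      exacts [⟨0, rfl⟩, ⟨1, rfl⟩, ⟨2, rfl⟩, ⟨3, rfl⟩]
    obtain ⟨v, k⟩ := a
    obtain ⟨w, l⟩ := b
    rintro rfl
    exact (key v k).symm.trans (key v l)

lemma numOrbits_sup : numOrbits (cyc (rot m) ⊔ cyc (flip m)) ≤ 1 := by
  set s := cyc (rot m) ⊔ cyc (flip m) with hs
  have hr : ∀ v k l, s (v, k) (v, l) := fun v k l =>
    (le_sup_left : cyc (rot m) ≤ s) ((sameCycle_rot (v, k) (v, l)).2 rfl)
  have hf : ∀ d, s d (flip m d) := fun d => (le_sup_right : cyc (flip m) ≤ s) (cyc_le_iff.1 le_rfl d)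
  have h1 : ∀ (i : ℕ) (hi : i < m + 1) (j : Fin (m + 1)), s ((0, j), 0) ((⟨i, hi⟩, j), 0) := by
    intro i
    induction i with
    | zero => intro _ j; exact hr _ _ _
    | succ i ih =>
      intro hi j
      refine s.trans (ih (by omega) j) (s.trans (hf _) ?_)
      have : flip m ((⟨i, by omega⟩, j), 0) = ((⟨i + 1, hi⟩, j), 2) := by
        rw [flip_apply]; simp only [flipFun, hi, dite_true]
      rw [this]
      exact hr _ _ _
  have h2 : ∀ (j : ℕ) (hj : j < m + 1), s ((0, 0), 0) ((0, ⟨j, hj⟩), 0) := by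
    intro j
    induction j with
    | zero => intro _; exact hr _ _ _
    | succ j ih =>
      intro hj
      refine s.trans (ih (by omega)) (s.trans (hr _ 0 1) (s.trans (hf _) ?_))
      have : flip m ((0, ⟨j, by omega⟩), 1) = ((0, ⟨j + 1, hj⟩), 3) := by
        rw [flip_apply]; simp only [flipFun, hj, dite_true]
      rw [this]
      exact hr _ _ _
  have h3 : ∀ d, s ((0, 0), 0) d := by
    rintro ⟨⟨i, j⟩, k⟩
    exact s.trans (h2 j.1 j.2) (s.trans (h1 i.1 i.2 j) (hr _ _ _))
  unfold numOrbits
  have : Subsingleton (Quotient s) := by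
    constructor
    intro x y
    induction x using Quotient.inductionOn with | _ x =>
    induction y using Quotient.inductionOn with | _ y =>
    exact Quotient.sound (s.trans (s.symm (h3 x)) (h3 y))
  exact Finite.card_le_one_iff_subsingleton.2 this

lemma isSpherical (m : ℕ) : IsSpherical (flip m) (Prod.fst : GridDart m → _) := by
  refine ⟨rot m, sameCycle_rot, ?_⟩
  have hV : Nat.card (Fin (m + 1) × Fin (m + 1)) ≤ numOrbits (cyc (rot m)) :=
    card_le_numOrbits Prod.fst (fun v => ⟨(v, 0), rfl⟩) fun x => rfl
  have hE : Nat.card ((Fin (m + 2) × Fin (m + 1)) ⊕ (Fin (m + 2) × Fin (m + 1))) ≤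
      numOrbits (cyc (flip m)) := by
    refine card_le_numOrbits edge ?_ edge_flip
    rintro (⟨a, b⟩ | ⟨a, b⟩)
    · induction a using Fin.cases with
      | zero => exact ⟨((0, b), 2), rfl⟩
      | succ a => exact ⟨((a, b), 0), rfl⟩
    · induction a using Fin.cases with
      | zero => exact ⟨((b, 0), 3), rfl⟩
      | succ a => exact ⟨((b, a), 1), rfl⟩
  have hF : Nat.card (Option (Fin m × Fin m)) ≤ numOrbits (cyc (rot m * flip m)) := by
    refine card_le_numOrbits cell ?_ cell_rot_flip
    rintro (_ | ⟨a, b⟩)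
    · exact ⟨((0, 0), 3), by simp [cell, mkCell]⟩
    · refine ⟨((a.castSucc, b.castSucc), 1), ?_⟩
      simp [cell, mkCell]
  have hC := numOrbits_sup (m := m)
  simp only [Nat.card_eq_fintype_card, Fintype.card_fin,
    Fintype.card_option, Fintype.card_prod, Fintype.card_sum] at hV hE hF
  unfold eulerDefect
  simp only [Nat.card_eq_fintype_card, Fintype.card_prod, Fintype.card_fin]
  zify at *
  nlinarith

lemma adj_of_eq {x y : Fin (m + 1) × Fin (m + 1)}
    (h : (x.1 = y.1 ∧ (x.2.1 + 1 = y.2.1 ∨ y.2.1 + 1 = x.2.1)) ∨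
      (x.2 = y.2 ∧ (x.1.1 + 1 = y.1.1 ∨ y.1.1 + 1 = x.1.1))) :
    ∃ d : GridDart m, d.1 = x ∧ (flip m d).1 = y := by
  obtain ⟨i, j⟩ := x
  obtain ⟨i', j'⟩ := y
  simp only at h
  rcases h with ⟨rfl, h | h⟩ | ⟨rfl, h | h⟩
  · refine ⟨((i, j), 1), rfl, ?_⟩
    rw [flip_apply]; simp only [flipFun]; split_ifs <;> ext <;> simp <;> omega
  · refine ⟨((i, j), 3), rfl, ?_⟩
    rw [flip_apply]; simp only [flipFun]; split_ifs <;> ext <;> simp <;> omega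
  · refine ⟨((i, j), 0), rfl, ?_⟩
    rw [flip_apply]; simp only [flipFun]; split_ifs <;> ext <;> simp <;> omega
  · refine ⟨((i, j), 2), rfl, ?_⟩
    rw [flip_apply]; simp only [flipFun]; split_ifs <;> ext <;> simp <;> omega

end Grid
end PermOrbit

namespace PermOrbit

open Equiv Relation

lemma exists_exit {W : Type*} {S : W → W → Prop} {H : Set W} {a b : W} (h : ReflTransGen S a b)
    (ha : a ∉ H) (hb : b ∈ H) :
    ∃ u v, ReflTransGen (fun x y => S x y ∧ y ∉ H) a u ∧ S u v ∧ v ∈ H := by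
  induction h using ReflTransGen.head_induction_on with
  | refl => exact (ha hb).elim
  | @head a c hac _ ih =>
    by_cases hc : c ∈ H
    · exact ⟨a, c, .refl, hac, hc⟩
    · obtain ⟨u, v, h1, h2⟩ := ih hc
      exact ⟨u, v, .head ⟨hac, hc⟩ h1, h2⟩

lemma reflTransGen_symm {W : Type*} {S : W → W → Prop} (hS : ∀ x y, S x y → S y x) {a b : W}
    (h : ReflTransGen S a b) : ReflTransGen S b a := by
  induction h with
  | refl => exact .refl
  | tail _ k ih => exact .head (hS _ _ k) ih

lemma IsSpherical.of_connIn {W W' D E : Type*} [Finite D] [Finite E] {α : Perm D} {tail : D → W}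
    (h : IsSpherical α tail) (hα : ∀ a, α (α a) = a) {α' : Perm E} (hα' : ∀ a, α' (α' a) = a)
    {tail' : E → W'} (hloop : ∀ a, tail' a ≠ tail' (α' a))
    {R : W → W → Prop} (hR : ∀ x y, R x y → ∃ d, tail d = x ∧ tail (α d) = y)
    (C : W' → Set W) (hC : ∀ i j x, x ∈ C i → x ∈ C j → i = j) (hconn : ∀ i, ConnIn R (C i))
    (N : E → Set W) (hN : ∀ d, ConnIn R (N d)) (hNα : ∀ d, N (α' d) = N d)
    (hNN : ∀ d d' x, x ∈ N d → x ∈ N d' → d' = d ∨ d' = α' d)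
    (hNC : ∀ d, ∃ x ∈ N d, x ∈ C (tail' d))
    (hNC' : ∀ d w x, x ∈ N d → x ∈ C w → w = tail' d ∨ w = tail' (α' d)) :
    IsSpherical α' tail' := by
  classical
  choose a ha ha' using hNC
  have hex : ∀ d, ∃ g : D, ReflTransGen (fun x y => (R x y ∧ x ∈ N d ∧ y ∈ N d) ∧
      y ∉ C (tail' (α' d))) (a d) (tail g) ∧ tail (α g) ∈ N d ∧ tail (α g) ∈ C (tail' (α' d)) := by
    intro d
    have h1 := hN d (a d) (ha d) (a (α' d)) (hNα d ▸ ha (α' d))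
    obtain ⟨u, v, k1, k2, k3⟩ := exists_exit (H := C (tail' (α' d))) h1
      (fun k => hloop d (hC _ _ _ (ha' d) k)) (ha' (α' d))
    obtain ⟨g, rfl, rfl⟩ := hR u v k2.1
    exact ⟨g, k1, k2.2.2, k3⟩
  choose g hg1 hg2 hg3 using hex
  have hreach : ∀ d z, ReflTransGen (fun x y => (R x y ∧ x ∈ N d ∧ y ∈ N d) ∧
      y ∉ C (tail' (α' d))) (a d) z → z ∈ N d ∧ z ∉ C (tail' (α' d)) := by
    intro d z hz
    induction hz with
    | refl => exact ⟨ha d, fun k => hloop d (hC _ _ _ (ha' d) k)⟩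
    | tail _ k _ => exact ⟨k.1.2.2, k.2⟩
  obtain ⟨f, hf⟩ : ∃ f : E → ℕ, Function.Injective f := by
    obtain ⟨n, ⟨e⟩⟩ := Finite.exists_equiv_fin E
    exact ⟨fun x => e x, Fin.val_injective.comp e.injective⟩
  let O : E → Prop := fun d => f d < f (α' d)
  have hO : ∀ d, O (α' d) ↔ ¬ O d := by
    intro d
    have : f d ≠ f (α' d) := fun k => hloop d (congrArg tail' (hf k))
    simp only [O, hα']
    omega
  let C' : W' → Set W := fun w => {z | z ∈ C w ∨ ∃ d, O d ∧ tail' d = w ∧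
    ReflTransGen (fun x y => (R x y ∧ x ∈ N d ∧ y ∈ N d) ∧ y ∉ C (tail' (α' d))) (a d) z}
  let rep : E → D := fun d => if O d then g d else α (g (α' d))
  have hCC' : ∀ d i x, O d → x ∈ C i → ReflTransGen (fun x y => (R x y ∧ x ∈ N d ∧ y ∈ N d) ∧
      y ∉ C (tail' (α' d))) (a d) x → i = tail' d := by
    intro d i x hd hx hr
    obtain ⟨h1, h2⟩ := hreach d x hr
    rcases hNC' d i x h1 hx with k | rfl
    · exact k
    · exact (h2 hx).elim
  have hC' : ∀ i j x, x ∈ C' i → x ∈ C' j → i = j := by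
    rintro i j x (h1 | ⟨d, h1, rfl, h2⟩) (k1 | ⟨e, k1, rfl, k2⟩)
    · exact hC _ _ _ h1 k1
    · exact hCC' e i x k1 h1 k2
    · exact (hCC' d j x h1 k1 h2).symm
    · rcases hNN d e x (hreach d x h2).1 (hreach e x k2).1 with rfl | rfl
      · rfl
      · exact ((hO d).1 k1 h1).elim
  have hmem : ∀ x, tail (rep x) ∈ C' (tail' x) := by
    intro x
    by_cases hx : O x
    · simp only [rep, if_pos hx]
      exact Or.inr ⟨x, hx, rfl, hg1 x⟩
    · simp only [rep, if_neg hx]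
      left
      simpa [hα'] using hg3 (α' x)
  have hrα : ∀ x, rep (α' x) = α (rep x) := by
    intro x
    by_cases hx : O x
    · have hx' : ¬ O (α' x) := by rw [hO]; exact not_not.2 hx
      simp only [rep, if_pos hx, if_neg hx', hα']
    · have hx' : O (α' x) := (hO x).2 hx
      simp only [rep, if_neg hx, if_pos hx', hα]
  have hrN : ∀ x, tail (rep x) ∈ N x := by
    intro x
    by_cases hx : O x
    · simp only [rep, if_pos hx]
      exact (hreach x _ (hg1 x)).1
    · simp only [rep, if_neg hx]
      simpa [hNα] using hg2 (α' x)
  refine h.minor hα C' hC' (fun i => ?_) (rep := rep) (fun x y hxy => ?_) hrα hmem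
  · have hS : ∀ x y, ((∃ d, tail d = x ∧ tail (α d) = y) ∧ x ∈ C' i ∧ y ∈ C' i) →
        ((∃ d, tail d = y ∧ tail (α d) = x) ∧ y ∈ C' i ∧ x ∈ C' i) := by
      rintro x y ⟨⟨d, rfl, rfl⟩, h1, h2⟩
      exact ⟨⟨α d, rfl, by rw [hα]⟩, h2, h1⟩
    have hroot : ∀ x ∈ C' i, ∃ c ∈ C i, ReflTransGen
        (fun x y => (∃ d, tail d = x ∧ tail (α d) = y) ∧ x ∈ C' i ∧ y ∈ C' i) c x := by
      rintro x (hx | ⟨d, hd, rfl, hx⟩)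
      · exact ⟨x, hx, .refl⟩
      · refine ⟨a d, ha' d, ?_⟩
        induction hx with
        | refl => exact .refl
        | tail k1 k2 ih =>
          exact ih.tail ⟨hR _ _ k2.1.1, Or.inr ⟨d, hd, rfl, k1⟩, Or.inr ⟨d, hd, rfl, k1.tail k2⟩⟩
    intro x hx y hy
    obtain ⟨c, hc, hcx⟩ := hroot x hx
    obtain ⟨c', hc', hcy⟩ := hroot y hy
    refine (reflTransGen_symm hS hcx).trans (.trans ?_ hcy)
    refine ReflTransGen.mono ?_ _ _ (hconn i c hc c' hc')
    exact fun x y k => ⟨hR x y k.1, Or.inl k.2.1, Or.inl k.2.2⟩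
  · have h1 := hrN y
    rw [← hxy] at h1
    rcases hNN x y _ (hrN x) h1 with k | rfl
    · exact k.symm
    · have h2 := hmem (α' x)
      rw [← hxy] at h2
      exact (hloop x (hC' _ _ _ (hmem x) h2)).elim

namespace Grid

/-- Adjacency of grid vertices. -/
def Adj {m : ℕ} (x y : Fin (m + 1) × Fin (m + 1)) : Prop :=
  (x.1 = y.1 ∧ (x.2.1 + 1 = y.2.1 ∨ y.2.1 + 1 = x.2.1)) ∨
      (x.2 = y.2 ∧ (x.1.1 + 1 = y.1.1 ∨ y.1.1 + 1 = x.1.1))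

lemma Adj.symm {m : ℕ} {x y : Fin (m + 1) × Fin (m + 1)} (h : Adj x y) : Adj y x := by
  rcases h with ⟨h, k | k⟩ | ⟨h, k | k⟩
  · exact Or.inl ⟨h.symm, Or.inr k⟩
  · exact Or.inl ⟨h.symm, Or.inl k⟩
  · exact Or.inr ⟨h.symm, Or.inr k⟩
  · exact Or.inr ⟨h.symm, Or.inl k⟩

lemma reflTransGen_of_close {m : ℕ} {S : Set (Fin (m + 1) × Fin (m + 1))}
    {a b a' b' : Fin (m + 1)} (h1 : a.1 ≤ a'.1 + 1) (h2 : a'.1 ≤ a.1 + 1) (h3 : b.1 ≤ b'.1 + 1)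
    (h4 : b'.1 ≤ b.1 + 1) (k1 : (a, b) ∈ S) (k2 : (a', b) ∈ S) (k3 : (a', b') ∈ S) :
    ReflTransGen (fun x y => Adj x y ∧ x ∈ S ∧ y ∈ S) (a, b) (a', b') := by
  have step : ∀ x y, x ∈ S → y ∈ S → (x = y ∨ Adj x y) →
      ReflTransGen (fun x y => Adj x y ∧ x ∈ S ∧ y ∈ S) x y := by
    rintro x y hx hy (rfl | hxy)
    · exact .refl
    · exact .single ⟨hxy, hx, hy⟩
  refine (step (a, b) (a', b) k1 k2 ?_).trans (step (a', b) (a', b') k2 k3 ?_)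
  · by_cases h : a = a'
    · exact Or.inl (by rw [h])
    · refine Or.inr (Or.inr ⟨rfl, ?_⟩)
      have : a.1 ≠ a'.1 := fun k => h (Fin.ext k)
      dsimp only
      omega
  · by_cases h : b = b'
    · exact Or.inl (by rw [h])
    · refine Or.inr (Or.inl ⟨rfl, ?_⟩)
      have : b.1 ≠ b'.1 := fun k => h (Fin.ext k)
      dsimp only
      omega

/-- The grid vertices `z` such that the point corresponding to `z` (for the grid of mesh `h` with
corner `(-r, -r)`) is at distance at most `h` from `K`. -/
def disc (m : ℕ) (r h : ℝ) (K : Set (ℝ × ℝ)) : Set (Fin (m + 1) × Fin (m + 1)) :=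
  {z | ∃ k ∈ K, |k.1 - (-r + z.1.1 * h)| ≤ h ∧ |k.2 - (-r + z.2.1 * h)| ≤ h}

lemma disc_mono {m : ℕ} {r h : ℝ} {K L : Set (ℝ × ℝ)} (hKL : K ⊆ L) :
    disc m r h K ⊆ disc m r h L := fun _ ⟨k, hk, hz⟩ => ⟨k, hKL hk, hz⟩

lemma exists_near {m : ℕ} {r h : ℝ} (hh : 0 < h) (hm : 2 * r / h + 1 ≤ m) {x : ℝ} (hx : |x| ≤ r) :
    ∃ i : Fin (m + 1), |x - (-r + i.1 * h)| ≤ h / 2 := by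
  rw [abs_le] at hx
  have h0 : 0 ≤ (x + r) / h + 1 / 2 := by
    have : 0 ≤ (x + r) / h := div_nonneg (by linarith) hh.le
    linarith
  have h1 := Nat.floor_le h0
  have h2 := Nat.lt_floor_add_one ((x + r) / h + 1 / 2)
  have h3 : (x + r) / h ≤ 2 * r / h := by gcongr; linarith
  have h4 : ⌊(x + r) / h + 1 / 2⌋₊ < m + 1 := by
    have : ((⌊(x + r) / h + 1 / 2⌋₊ : ℕ) : ℝ) < (m + 1 : ℕ) := by push_cast; linarith
    exact_mod_cast this
  refine ⟨⟨⌊(x + r) / h + 1 / 2⌋₊, h4⟩, ?_⟩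
  dsimp only
  generalize ((⌊(x + r) / h + 1 / 2⌋₊ : ℕ) : ℝ) = n at h1 h2
  obtain ⟨y, rfl⟩ : ∃ y, x = y * h - r := ⟨(x + r) / h, by field_simp; ring⟩
  have h5 : (y * h - r + r) / h = y := by field_simp; ring
  rw [h5] at h1 h2
  rw [abs_le]
  constructor <;> nlinarith

lemma close_of_near {r h x : ℝ} (hh : 0 < h) {i j : ℕ} (hi : |x - (-r + i * h)| ≤ h)
    (hj : |x - (-r + j * h)| ≤ h / 2) : i ≤ j + 1 ∧ j ≤ i + 1 := by
  rw [abs_le] at hi hj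
  constructor
  · have : (i : ℝ) < (j + 2 : ℕ) := by push_cast; nlinarith
    have := Nat.cast_lt.1 this
    omega
  · have : (j : ℝ) < (i + 2 : ℕ) := by push_cast; nlinarith
    have := Nat.cast_lt.1 this
    omega

lemma connIn_disc {m : ℕ} {r h : ℝ} (hh : 0 < h) (hm : 2 * r / h + 1 ≤ m) {K : Set (ℝ × ℝ)}
    (hK : IsPreconnected K) (hKr : ∀ k ∈ K, |k.1| ≤ r ∧ |k.2| ≤ r) : ConnIn Adj (disc m r h K) := by
  have hS : ∀ x y, (Adj x y ∧ x ∈ disc m r h K ∧ y ∈ disc m r h K) →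
      (Adj y x ∧ y ∈ disc m r h K ∧ x ∈ disc m r h K) := fun x y k => ⟨k.1.symm, k.2.2, k.2.1⟩
  let P : ℝ × ℝ → ℝ × ℝ → Prop := fun k l => ∀ z ∈ disc m r h {k}, ∀ w ∈ disc m r h {l},
    ReflTransGen (fun x y => Adj x y ∧ x ∈ disc m r h K ∧ y ∈ disc m r h K) z w
  have hcent : ∀ k ∈ K, ∃ c : Fin (m + 1) × Fin (m + 1), |k.1 - (-r + c.1.1 * h)| ≤ h / 2 ∧
      |k.2 - (-r + c.2.1 * h)| ≤ h / 2 := by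
    intro k hk
    obtain ⟨i, hi⟩ := exists_near hh hm (hKr k hk).1
    obtain ⟨j, hj⟩ := exists_near hh hm (hKr k hk).2
    exact ⟨(i, j), hi, hj⟩
  have hcenter : ∀ k ∈ K, ∀ c : Fin (m + 1) × Fin (m + 1), |k.1 - (-r + c.1.1 * h)| ≤ h / 2 →
      |k.2 - (-r + c.2.1 * h)| ≤ h / 2 → ∀ z ∈ disc m r h {k},
      ReflTransGen (fun x y => Adj x y ∧ x ∈ disc m r h K ∧ y ∈ disc m r h K) z c := by
    rintro k hk ⟨c1, c2⟩ h1 h2 ⟨z1, z2⟩ ⟨k', hk', h3, h4⟩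
    rw [Set.mem_singleton_iff] at hk'
    subst hk'
    have e1 := close_of_near hh h3 h1
    have e2 := close_of_near hh h4 h2
    exact reflTransGen_of_close e1.1 e1.2 e2.1 e2.2 ⟨k', hk, h3, h4⟩
      ⟨k', hk, by dsimp only at h1 ⊢; linarith, h4⟩
      ⟨k', hk, by dsimp only at h1 ⊢; linarith, by dsimp only at h2 ⊢; linarith⟩
  have hP : ∀ k ∈ K, ∀ l ∈ K, P k l := by
    intro k hk l hl
    refine hK.induction₂ P ?_ ?_ ?_ hk hl
    · intro x hx
      have hball : Metric.ball x (h / 2) ∈ nhdsWithin x K :=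
        mem_nhdsWithin_of_mem_nhds (Metric.ball_mem_nhds x (by positivity))
      filter_upwards [hball, self_mem_nhdsWithin] with y hy hyK z hz w hw
      obtain ⟨c, hc1, hc2⟩ := hcent x hx
      refine (hcenter x hx c hc1 hc2 z hz).trans ?_
      obtain ⟨c', hc1', hc2'⟩ := hcent y hyK
      have hcy : c ∈ disc m r h {y} := by
        rw [Metric.mem_ball, Prod.dist_eq, max_lt_iff, Real.dist_eq, Real.dist_eq] at hy
        refine ⟨y, rfl, ?_, ?_⟩
        · have := abs_sub_le y.1 x.1 (-r + c.1.1 * h)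
          linarith
        · have := abs_sub_le y.2 x.2 (-r + c.2.1 * h)
          linarith
      exact (hcenter y hyK c' hc1' hc2' c hcy).trans
        (reflTransGen_symm hS (hcenter y hyK c' hc1' hc2' w hw))
    · intro x y z _ hy _ h1 h2 u hu w hw
      obtain ⟨c, hc1, hc2⟩ := hcent y hy
      have hcy : c ∈ disc m r h {y} := ⟨y, rfl, by linarith, by linarith⟩
      exact (h1 u hu c hcy).trans (h2 c hcy w hw)
    · intro x y _ _ h1 u hu w hw
      exact reflTransGen_symm hS (h1 w hw u hu)
  rintro z ⟨k, hk, hz⟩ w ⟨l, hl, hw⟩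
  exact hP k hk l hl z ⟨k, rfl, hz⟩ w ⟨l, rfl, hw⟩

lemma disc_disjoint {m : ℕ} {r h : ℝ} {K L : Set (ℝ × ℝ)}
    (hKL : ∀ k ∈ K, ∀ l ∈ L, 2 * h < dist k l) {z : Fin (m + 1) × Fin (m + 1)}
    (hK : z ∈ disc m r h K) (hL : z ∈ disc m r h L) : False := by
  obtain ⟨k, hk, h1, h2⟩ := hK
  obtain ⟨l, hl, h3, h4⟩ := hL
  have := hKL k hk l hl
  rw [Prod.dist_eq, lt_max_iff, Real.dist_eq, Real.dist_eq] at this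
  rw [abs_sub_comm] at h3 h4
  rcases this with k1 | k1
  · have := abs_sub_le k.1 (-r + z.1.1 * h) l.1
    linarith
  · have := abs_sub_le k.2 (-r + z.2.1 * h) l.2
    linarith

lemma disc_nonempty {m : ℕ} {r h : ℝ} (hh : 0 < h) (hm : 2 * r / h + 1 ≤ m) {K : Set (ℝ × ℝ)}
    (hK : K.Nonempty) (hKr : ∀ k ∈ K, |k.1| ≤ r ∧ |k.2| ≤ r) : (disc m r h K).Nonempty := by
  obtain ⟨k, hk⟩ := hK
  obtain ⟨i, hi⟩ := exists_near hh hm (hKr k hk).1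
  obtain ⟨j, hj⟩ := exists_near hh hm (hKr k hk).2
  exact ⟨(i, j), k, hk, by dsimp only; linarith, by dsimp only; linarith⟩

end Grid

lemma exists_uniform_separation {ι X : Type*} [Finite ι] [PseudoMetricSpace X] (A : ι → Set X)
    (hA : ∀ i, IsCompact (A i)) (hA' : ∀ i, IsClosed (A i)) :
    ∃ ε > 0, ∀ i j, Disjoint (A i) (A j) → ∀ x ∈ A i, ∀ y ∈ A j, ε < dist x y := by
  cases nonempty_fintype ι
  have h1 : ∀ p : ι × ι, ∃ ε > 0, Disjoint (A p.1) (A p.2) →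
      ∀ x ∈ A p.1, ∀ y ∈ A p.2, ε < dist x y := by
    rintro ⟨i, j⟩
    by_cases hij : Disjoint (A i) (A j)
    · obtain ⟨r, hr, h⟩ := Metric.exists_pos_forall_lt_edist (hA i) (hA' j) hij
      refine ⟨r, NNReal.coe_pos.2 hr, fun _ x hx y hy => ?_⟩
      have := h x hx y hy
      rw [edist_nndist] at this
      exact_mod_cast this
    · exact ⟨1, one_pos, fun h => (hij h).elim⟩
  choose f hf hf' using h1
  by_cases hι : Nonempty (ι × ι)
  · obtain ⟨p, hp⟩ := Finite.exists_min f
    exact ⟨f p, hf p, fun i j hij x hx y hy => (hp (i, j)).trans_lt (hf' (i, j) hij x hx y hy)⟩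
  · exact ⟨1, one_pos, fun i j => (hι ⟨(i, j)⟩).elim⟩

/-- A multigraph whose vertices are represented by pairwise disjoint plane continua, and whose
edges are represented by pairwise disjoint plane continua meeting those of their endpoints only,
is spherical. -/
theorem isSpherical_of_continua {E W : Type*} [Finite E] {α : Perm E} (hα : ∀ a, α (α a) = a)
    {tail : E → W} (hloop : ∀ a, tail a ≠ tail (α a)) {K : W → Set (ℝ × ℝ)}
    {M : E → Set (ℝ × ℝ)} (hK : ∀ d, IsCompact (K (tail d))) (hKc : ∀ d, IsPreconnected (K (tail d)))
    (hM : ∀ d, IsCompact (M d)) (hMc : ∀ d, IsPreconnected (M d)) (hMα : ∀ d, M (α d) = M d)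
    (hKK : ∀ d e, tail d ≠ tail e → Disjoint (K (tail d)) (K (tail e)))
    (hMM : ∀ d e, e ≠ d → e ≠ α d → Disjoint (M d) (M e))
    (hMK : ∀ d, (M d ∩ K (tail d)).Nonempty)
    (hMK' : ∀ d e, tail e ≠ tail d → tail e ≠ tail (α d) → Disjoint (M d) (K (tail e))) :
    IsSpherical α tail := by
  classical
  let A : E ⊕ E → Set (ℝ × ℝ) := Sum.elim (fun d => K (tail d)) M
  have hA : ∀ i, IsCompact (A i) := by
    rintro (d | d)
    exacts [hK d, hM d]
  obtain ⟨ε, hε, hsep⟩ := exists_uniform_separation A hA fun i => (hA i).isClosed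
  obtain ⟨r, hr⟩ : ∃ r : ℝ, ∀ i, ∀ k ∈ A i, |k.1| ≤ r ∧ |k.2| ≤ r := by
    obtain ⟨r, hr⟩ := (isCompact_iUnion hA).isBounded.exists_norm_le
    refine ⟨r, fun i k hk => ?_⟩
    have h1 := hr k (Set.mem_iUnion.2 ⟨i, hk⟩)
    exact ⟨(norm_fst_le k).trans h1, (norm_snd_le k).trans h1⟩
  set h := ε / 2 with hh
  have hh0 : 0 < h := by positivity
  have h2h : 2 * h = ε := by rw [hh]; ring
  obtain ⟨m, hm⟩ := exists_nat_ge (2 * r / h + 1)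
  have hdisj : ∀ i j z, Disjoint (A i) (A j) → z ∈ Grid.disc m r h (A i) →
      z ∈ Grid.disc m r h (A j) → False := by
    intro i j z hij h1 h2
    exact Grid.disc_disjoint (fun k hk l hl => by rw [h2h]; exact hsep i j hij k hk l hl) h1 h2
  refine (Grid.isSpherical m).of_connIn Grid.flip_flip hα hloop (R := Grid.Adj)
    (fun x y hxy => Grid.adj_of_eq hxy)
    (C := fun w => {z | ∃ d, tail d = w ∧ z ∈ Grid.disc m r h (K w)}) ?_ ?_
    (N := fun d => Grid.disc m r h (M d)) ?_ ?_ ?_ ?_ ?_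
  · rintro _ _ x ⟨d, rfl, hd⟩ ⟨e, rfl, he⟩
    by_contra hne
    exact hdisj (Sum.inl d) (Sum.inl e) x (hKK d e hne) hd he
  · intro w
    by_cases hw : ∃ d, tail d = w
    · obtain ⟨d, rfl⟩ := hw
      have := Grid.connIn_disc hh0 hm (hKc d) (hr (Sum.inl d))
      convert this using 1
      ext z
      exact ⟨fun ⟨_, _, k⟩ => k, fun k => ⟨d, rfl, k⟩⟩
    · rintro x ⟨d, hd, -⟩
      exact (hw ⟨d, hd⟩).elim
  · intro d
    exact Grid.connIn_disc hh0 hm (hMc d) (hr (Sum.inr d))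
  · intro d
    simp only [hMα]
  · intro d e x hd he
    by_contra hne
    push Not at hne
    exact hdisj (Sum.inr d) (Sum.inr e) x (hMM d e hne.1 hne.2) hd he
  · intro d
    obtain ⟨x, hx⟩ := Grid.disc_nonempty hh0 hm (hMK d) fun k hk => hr (Sum.inr d) k hk.1
    exact ⟨x, Grid.disc_mono Set.inter_subset_left hx, d, rfl,
      Grid.disc_mono Set.inter_subset_right hx⟩
  · rintro d _ x hd ⟨e, rfl, he⟩
    by_contra hne
    push Not at hne
    exact hdisj (Sum.inr d) (Sum.inl e) x (hMK' d e hne.1 hne.2) hd he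

end PermOrbit

namespace PermOrbit

open Equiv Set

/-- Oriented edge curves of a 1-planar drawing, with the crossing relation and the parameters at
which crossings happen. -/
structure DartCurves {V : Type*} (G : SimpleGraph V) where
  curve : G.Dart → ℝ → ℝ × ℝ
  cross : G.Dart → G.Dart → Prop
  time : G.Dart → ℝ
  continuousOn : ∀ d, ContinuousOn (curve d) (Icc 0 1)
  curve_symm : ∀ d s, curve d.symm s = curve d (1 - s)
  curve_zero : ∀ d e, d.fst = e.fst → curve d 0 = curve e 0
  cross_comm : ∀ d e, cross d e → cross e d
  cross_symm : ∀ d e, cross d e → cross d e.symm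
  cross_ne : ∀ d e, cross d e → e ≠ d
  cross_unique : ∀ d e f, cross d e → cross d f → f = e ∨ f = e.symm
  time_pos : ∀ d, 0 < time d
  time_symm : ∀ d, time d.symm = 1 - time d
  curve_time : ∀ d e, cross d e → curve d (time d) = curve e (time e)
  eq_cases : ∀ d e s t, 0 ≤ s → s < 1 → 0 ≤ t → t < 1 → curve d s = curve e t →
    (s = 0 ∧ t = 0 ∧ d.fst = e.fst) ∨ (0 < s ∧ 0 < t ∧ ((e = d ∧ t = s) ∨ (e = d.symm ∧ t = 1 - s) ∨
      (cross d e ∧ s = time d ∧ t = time e)))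

lemma exists_oriented {V : Type*} {G : SimpleGraph V} (P : OnePlanarDrawing G) :
    ∃ curve : G.Dart → ℝ → ℝ × ℝ, (∀ d s, curve d.symm s = curve d (1 - s)) ∧
      (∀ d, curve d 0 = P.pos d.fst) ∧
      ∀ d : G.Dart, (∀ s, curve d s = P.arc ⟨d.edge, d.edge_mem⟩ s) ∨
        (∀ s, curve d s = P.arc ⟨d.edge, d.edge_mem⟩ (1 - s)) := by
  classical
  let E : G.Dart → G.edgeSet := fun d => ⟨d.edge, d.edge_mem⟩
  have hE : ∀ d, E d.symm = E d := fun d => Subtype.ext d.edge_symm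
  have hends : ∀ d, (P.arc (E d) 0 = P.pos d.fst ∧ P.arc (E d) 1 = P.pos d.snd) ∨
      (P.arc (E d) 0 = P.pos d.snd ∧ P.arc (E d) 1 = P.pos d.fst) := by
    intro d
    obtain ⟨u, v, h, h0, h1⟩ := P.arc_ends (E d)
    have h' : s(d.fst, d.snd) = s(u, v) := h
    rcases Sym2.eq_iff.1 h' with ⟨h2, h3⟩ | ⟨h2, h3⟩
    · exact Or.inl ⟨h2 ▸ h0, h3 ▸ h1⟩
    · exact Or.inr ⟨h3 ▸ h0, h2 ▸ h1⟩
  have hne : ∀ d : G.Dart, P.pos d.fst ≠ P.pos d.snd := fun d h => d.fst_ne_snd (P.pos_inj h)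
  refine ⟨fun d s => if P.arc (E d) 0 = P.pos d.fst then P.arc (E d) s else P.arc (E d) (1 - s),
    fun d s => ?_, fun d => ?_, fun d => ?_⟩
  · dsimp only
    rw [hE]
    have h1 : d.symm.fst = d.snd := rfl
    rw [h1]
    rcases hends d with ⟨h, -⟩ | ⟨h, -⟩
    · rw [if_neg (by rw [h]; exact hne d), if_pos h]
    · rw [if_pos h, if_neg (by rw [h]; exact (hne d).symm), sub_sub_cancel]
  · dsimp only
    rcases hends d with ⟨h, -⟩ | ⟨h, h'⟩
    · rw [if_pos h, h]
    · rw [if_neg (by rw [h]; exact (hne d).symm), sub_zero, h']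
  · dsimp only
    split_ifs
    · exact Or.inl fun _ => rfl
    · exact Or.inr fun _ => rfl

lemma OnePlanarDrawing.exists_dartCurves {V : Type*} {G : SimpleGraph V} (P : OnePlanarDrawing G) :
    Nonempty (DartCurves G) := by
  classical
  obtain ⟨δ, hsymm, hzero, hδ⟩ := exists_oriented P
  have hflip : ∀ s ∈ Ioo (0 : ℝ) 1, 1 - s ∈ Ioo (0 : ℝ) 1 := fun s hs =>
    ⟨by linarith [hs.2], by linarith [hs.1]⟩
  have hcont : ∀ d, ContinuousOn (δ d) (Icc 0 1) := by
    intro d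
    rcases hδ d with h | h
    · rw [funext h]; exact P.arc_cont _
    · rw [funext h]
      refine (P.arc_cont _).comp (by fun_prop) fun s hs => ⟨by linarith [hs.2], by linarith [hs.1]⟩
  have hinj : ∀ d, InjOn (δ d) (Ioo 0 1) := by
    intro d s hs t ht hst
    rcases hδ d with h | h
    · rw [h, h] at hst
      exact P.arc_inj _ (Ioo_subset_Icc_self hs) (Ioo_subset_Icc_self ht) hst
    · rw [h, h] at hst
      have := P.arc_inj _ (Ioo_subset_Icc_self (hflip s hs)) (Ioo_subset_Icc_self (hflip t ht)) hst
      linarith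
  have havoid : ∀ d, ∀ s ∈ Ioo (0 : ℝ) 1, δ d s ∉ range P.pos := by
    intro d s hs
    rcases hδ d with h | h
    · rw [h]; exact P.arc_avoids _ s hs
    · rw [h]; exact P.arc_avoids _ _ (hflip s hs)
  have himg : ∀ d, ∀ s ∈ Ioo (0 : ℝ) 1, δ d s ∈ P.arc ⟨d.edge, d.edge_mem⟩ '' Ioo 0 1 := by
    intro d s hs
    rcases hδ d with h | h
    · rw [h]; exact ⟨s, hs, rfl⟩
    · rw [h]; exact ⟨_, hflip s hs, rfl⟩
  let cr : G.Dart → G.Dart → Prop := fun d e => d.edge ≠ e.edge ∧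
    ∃ s ∈ Ioo (0 : ℝ) 1, ∃ t ∈ Ioo (0 : ℝ) 1, δ d s = δ e t
  have hcr_meet : ∀ d e, d.edge ≠ e.edge → ∀ s ∈ Ioo (0 : ℝ) 1, ∀ t ∈ Ioo (0 : ℝ) 1, δ d s = δ e t →
      δ d s ∈ P.arc ⟨d.edge, d.edge_mem⟩ '' Ioo 0 1 ∩ P.arc ⟨e.edge, e.edge_mem⟩ '' Ioo 0 1 :=
    fun d e _ s hs t ht h => ⟨himg d s hs, h ▸ himg e t ht⟩
  have hedge : ∀ d e f, cr d e → cr d f → e.edge = f.edge := by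
    rintro d e f ⟨h1, s, hs, t, ht, hst⟩ ⟨h2, s', hs', t', ht', hst'⟩
    have := P.at_most_one_crossing ⟨d.edge, d.edge_mem⟩
      (x := ⟨e.edge, e.edge_mem⟩) ⟨fun k => h1 (congrArg Subtype.val k).symm,
        ⟨_, hcr_meet d e h1 s hs t ht hst⟩⟩
      (y := ⟨f.edge, f.edge_mem⟩) ⟨fun k => h2 (congrArg Subtype.val k).symm,
        ⟨_, hcr_meet d f h2 s' hs' t' ht' hst'⟩⟩
    exact congrArg Subtype.val this
  let X : G.Dart → ℝ → Prop := fun d s => s ∈ Ioo (0 : ℝ) 1 ∧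
    ∃ e : G.Dart, d.edge ≠ e.edge ∧ ∃ t ∈ Ioo (0 : ℝ) 1, δ d s = δ e t
  have hX : ∀ d s s', X d s → X d s' → s = s' := by
    rintro d s s' ⟨hs, e, h1, t, ht, hst⟩ ⟨hs', f, h2, t', ht', hst'⟩
    have hef := hedge d e f ⟨h1, s, hs, t, ht, hst⟩ ⟨h2, s', hs', t', ht', hst'⟩
    have k1 := hcr_meet d e h1 s hs t ht hst
    have k2 := hcr_meet d f h2 s' hs' t' ht' hst'
    have hef' : (⟨e.edge, e.edge_mem⟩ : G.edgeSet) = ⟨f.edge, f.edge_mem⟩ := Subtype.ext hef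
    rw [← hef'] at k2
    exact hinj d hs hs' (P.crossings_subsingleton _ _
      (fun k => h1 (congrArg Subtype.val k)) k1 k2)
  have hXsymm : ∀ d s, X d s → X d.symm (1 - s) := by
    rintro d s ⟨hs, e, h1, t, ht, hst⟩
    exact ⟨hflip s hs, e, by rwa [d.edge_symm], t, ht, by rw [hsymm, sub_sub_cancel, hst]⟩
  have hexX : ∀ d, ∃ s ∈ Ioo (0 : ℝ) 1, (∀ s', X d s' → s' = s) ∧ ((¬ ∃ s', X d s') → s = 1 / 2) := by
    intro d
    by_cases h : ∃ s', X d s'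
    · obtain ⟨s', hs'⟩ := h
      exact ⟨s', hs'.1, fun s'' hs'' => hX d _ _ hs'' hs', fun k => (k ⟨s', hs'⟩).elim⟩
    · exact ⟨1 / 2, by norm_num, fun s' hs' => (h ⟨s', hs'⟩).elim, fun _ => rfl⟩
  choose t ht htX ht0 using hexX
  have hpt : ∀ d e, cr d e → δ d (t d) = δ e (t e) := by
    rintro d e ⟨h1, s, hs, s', hs', hss⟩
    rw [← htX d s ⟨hs, e, h1, s', hs', hss⟩, ← htX e s' ⟨hs', d, h1.symm, s, hs, hss.symm⟩, hss]
  refine ⟨⟨δ, cr, t, hcont, hsymm, fun d e h => by rw [hzero, hzero, h], ?_, ?_, ?_, ?_,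
    fun d => (ht d).1, ?_, hpt, ?_⟩⟩
  · rintro d e ⟨h1, s, hs, t, ht, hst⟩
    exact ⟨h1.symm, t, ht, s, hs, hst.symm⟩
  · rintro d e ⟨h1, s, hs, t, ht, hst⟩
    exact ⟨by rwa [e.edge_symm], s, hs, 1 - t, hflip t ht, by rw [hsymm, sub_sub_cancel, hst]⟩
  · rintro d e ⟨h1, -⟩ rfl
    exact h1 rfl
  · intro d e f h1 h2
    exact (SimpleGraph.dart_edge_eq_iff _ _).1 (hedge d e f h1 h2).symm
  · intro d
    by_cases h : ∃ s, X d s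
    · obtain ⟨s, hs⟩ := h
      rw [← htX d s hs, ← htX d.symm _ (hXsymm d s hs)]
    · have h' : ¬ ∃ s, X d.symm s := by
        rintro ⟨s, hs⟩
        exact h ⟨1 - s, by simpa using hXsymm _ s hs⟩
      rw [ht0 d h, ht0 _ h']; norm_num
  · intro d e s s' hs hs1 hs' hs1' heq
    rcases hs.eq_or_lt with rfl | hs
    · rcases hs'.eq_or_lt with rfl | hs'
      · refine Or.inl ⟨rfl, rfl, P.pos_inj ?_⟩
        rw [← hzero, ← hzero, heq]
      · exact (havoid e s' ⟨hs', hs1'⟩ ⟨d.fst, by rw [← heq, hzero]⟩).elim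
    · rcases hs'.eq_or_lt with rfl | hs'
      · exact (havoid d s ⟨hs, hs1⟩ ⟨e.fst, by rw [heq, hzero]⟩).elim
      · refine Or.inr ⟨hs, hs', ?_⟩
        by_cases hde : d.edge = e.edge
        · rcases (SimpleGraph.dart_edge_eq_iff _ _).1 hde.symm with rfl | rfl
          · exact Or.inl ⟨rfl, (hinj _ ⟨hs, hs1⟩ ⟨hs', hs1'⟩ heq).symm⟩
          · rw [hsymm] at heq
            have := hinj d ⟨hs, hs1⟩ (hflip _ ⟨hs', hs1'⟩) heq
            exact Or.inr (Or.inl ⟨rfl, by linarith⟩)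
        · refine Or.inr (Or.inr ⟨⟨hde, s, ⟨hs, hs1⟩, s', ⟨hs', hs1'⟩, heq⟩, ?_, ?_⟩)
          · exact htX d s ⟨⟨hs, hs1⟩, e, hde, s', ⟨hs', hs1'⟩, heq⟩
          · exact htX e s' ⟨⟨hs', hs1'⟩, d, Ne.symm hde, s, ⟨hs, hs1⟩, heq.symm⟩

end PermOrbit

namespace PermOrbit

open Equiv Set

namespace DartCurves
variable {V : Type*} {G : SimpleGraph V} (C : DartCurves G)

def Inner (d : G.Dart) : Prop := ∃ e, C.cross d e ∧ e.fst = d.fst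

/-- `d` crosses an edge with which it shares no endpoint. -/
def Proper (d : G.Dart) : Prop := (∃ e, C.cross d e) ∧ ¬ C.Inner d ∧ ¬ C.Inner d.symm

variable {C}

lemma cross_symm_left {d e : G.Dart} (h : C.cross d e) : C.cross d.symm e :=
  C.cross_comm _ _ (C.cross_symm _ _ (C.cross_comm _ _ h))

lemma cross_ne_symm {d e : G.Dart} (h : C.cross d e) : e ≠ d.symm := by
  rintro rfl
  have := C.cross_symm _ _ h
  rw [d.symm_symm] at this
  exact C.cross_ne _ _ this rfl

lemma eq_of_ends {d e : G.Dart} (h : d.fst = e.fst) (h' : d.snd = e.snd) : d = e := by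
  ext <;> assumption

lemma Inner.not_symm {d : G.Dart} (h : C.Inner d) : ¬ C.Inner d.symm := by
  rintro ⟨f, h1, h2⟩
  obtain ⟨e, k1, k2⟩ := h
  have h3 : C.cross d f := by simpa using cross_symm_left h1
  rcases C.cross_unique d e f k1 h3 with rfl | rfl
  · exact d.fst_ne_snd (k2.symm.trans h2)
  · exact C.cross_ne _ _ k1 (eq_of_ends k2 h2)

lemma Inner.fst_eq {d e : G.Dart} (hde : C.cross d e) (hd : C.Inner d) (he : C.Inner e) :
    d.fst = e.fst := by
  obtain ⟨f, h1, h2⟩ := hd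
  obtain ⟨g, k1, k2⟩ := he
  rcases C.cross_unique d e f hde h1 with rfl | rfl
  · exact h2.symm
  · rcases C.cross_unique e d g (C.cross_comm _ _ hde) k1 with rfl | rfl
    · exact k2
    · exact (cross_ne_symm hde (eq_of_ends k2.symm h2)).elim

lemma Proper.of_cross {d e : G.Dart} (hd : C.Proper d) (hde : C.cross d e) : C.Proper e := by
  have key : ∀ e', C.cross d e' → ¬ C.Inner e' := by
    rintro e' h ⟨g, k1, k2⟩
    rcases C.cross_unique e' d g (C.cross_comm _ _ h) k1 with rfl | rfl
    · exact hd.2.1 ⟨e', h, k2.symm⟩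
    · exact hd.2.2 ⟨e', cross_symm_left h, k2.symm⟩
  exact ⟨⟨d, C.cross_comm _ _ hde⟩, key e hde, key _ (C.cross_symm _ _ hde)⟩

lemma Proper.symm {d : G.Dart} (hd : C.Proper d) : C.Proper d.symm :=
  ⟨hd.1.imp fun _ => cross_symm_left, hd.2.2, by simpa using hd.2.1⟩

lemma proper_symm {d : G.Dart} : C.Proper d.symm ↔ C.Proper d :=
  ⟨fun h => by simpa using h.symm, Proper.symm⟩

lemma time_lt_one (d : G.Dart) : C.time d < 1 := by
  have := C.time_pos d.symm
  rw [C.time_symm] at this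
  linarith

variable (C) in
/-- The crossing point on a crossed dart. -/
def node (d : G.Dart) : ℝ × ℝ := C.curve d (C.time d)

lemma node_symm (d : G.Dart) : C.node d.symm = C.node d := by
  rw [node, C.curve_symm, C.time_symm, sub_sub_cancel, node]

lemma node_eq_cases {d e : G.Dart} (h : C.node e = C.node d) :
    e = d ∨ e = d.symm ∨ C.cross d e := by
  rcases C.eq_cases d e _ _ (C.time_pos d).le (time_lt_one d) (C.time_pos e).le (time_lt_one e)
    h.symm with ⟨h0, -⟩ | ⟨-, -, ⟨h1, -⟩ | ⟨h1, -⟩ | ⟨h1, -⟩⟩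
  · exact ((C.time_pos d).ne' h0).elim
  exacts [Or.inl h1, Or.inr (Or.inl h1), Or.inr (Or.inr h1)]

lemma Proper.exists_partner {d : G.Dart} (hd : C.Proper d) : ∃ e, C.Proper e ∧
    e.fst ≠ d.fst ∧ e.fst ≠ d.snd ∧ e.snd ≠ d.fst ∧ e.snd ≠ d.snd ∧ C.node e = C.node d ∧
    ∀ f, C.node f = C.node d → f = d ∨ f = d.symm ∨ f = e ∨ f = e.symm := by
  obtain ⟨e, he⟩ := hd.1
  refine ⟨e, hd.of_cross he, fun h => hd.2.1 ⟨e, he, h⟩, fun h => hd.2.2 ⟨e, cross_symm_left he, h⟩,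
    fun h => hd.2.1 ⟨e.symm, C.cross_symm _ _ he, h⟩,
    fun h => hd.2.2 ⟨e.symm, C.cross_symm _ _ (cross_symm_left he), h⟩,
    (C.curve_time _ _ he).symm, fun f hf => ?_⟩
  rcases node_eq_cases hf with h | h | h
  · exact Or.inl h
  · exact Or.inr (Or.inl h)
  · exact Or.inr (Or.inr (C.cross_unique _ _ _ he h))

open Classical in
variable (C) in
/-- The vertex region contains the initial segment of `d` up to this parameter. -/
noncomputable def reach (d : G.Dart) : ℝ :=
  if C.Inner d then (1 + 2 * C.time d) / 3 else C.time d / 3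

lemma reach_of_inner {d : G.Dart} (h : C.Inner d) : C.reach d = (1 + 2 * C.time d) / 3 := if_pos h

lemma reach_of_not_inner {d : G.Dart} (h : ¬ C.Inner d) : C.reach d = C.time d / 3 := if_neg h

lemma reach_pos (d : G.Dart) : 0 < C.reach d := by
  have := C.time_pos d
  unfold reach
  split_ifs <;> linarith

lemma reach_add_reach (d : G.Dart) : C.reach d + C.reach d.symm < 1 := by
  have := C.time_pos d
  have := time_lt_one (C := C) d
  have h3 := C.time_symm d
  by_cases h : C.Inner d
  · rw [reach_of_inner h, reach_of_not_inner h.not_symm]; linarith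
  · by_cases h' : C.Inner d.symm
    · rw [reach_of_not_inner h, reach_of_inner h']; linarith
    · rw [reach_of_not_inner h, reach_of_not_inner h']; linarith

lemma time_le_reach {d : G.Dart} (h : C.time d ≤ C.reach d) : C.Inner d := by
  by_contra h'
  rw [reach_of_not_inner h'] at h
  linarith [C.time_pos d]

lemma reach_lt_one (d : G.Dart) : C.reach d < 1 := by
  linarith [reach_add_reach (C := C) d, reach_pos (C := C) d.symm]

variable (C) in
/-- The parameters of the part of `d` outside the vertex and crossing regions. -/
def gap (d : G.Dart) : Set ℝ :=
  {s | (C.Proper d ∧ C.time d / 3 ≤ s ∧ s ≤ 2 * C.time d / 3) ∨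
    (¬ C.Proper d ∧ C.reach d ≤ s ∧ s ≤ 1 - C.reach d.symm)}

lemma gap_of_proper {d : G.Dart} (h : C.Proper d) :
    C.gap d = Icc (C.time d / 3) (2 * C.time d / 3) := by
  ext s; simp [gap, h]

lemma gap_of_not_proper {d : G.Dart} (h : ¬ C.Proper d) :
    C.gap d = Icc (C.reach d) (1 - C.reach d.symm) := by
  ext s; simp [gap, h]

lemma gap_bounds {d : G.Dart} {s : ℝ} (h : s ∈ C.gap d) : 0 < s ∧ s < 1 := by
  have h1 := C.time_pos d
  have h2 := time_lt_one (C := C) d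
  have h3 := reach_pos (C := C) d
  have h4 := reach_pos (C := C) d.symm
  rcases h with ⟨-, h5, h6⟩ | ⟨-, h5, h6⟩ <;> constructor <;> linarith

lemma gap_ne_time {d e : G.Dart} (hde : C.cross d e) {s : ℝ} (h : s ∈ C.gap d) : s ≠ C.time d := by
  rintro rfl
  have h1 := C.time_pos d
  rcases h with ⟨-, h5, h6⟩ | ⟨hp, h5, h6⟩
  · linarith
  · refine hp ⟨⟨e, hde⟩, fun hi => ?_, fun hi => ?_⟩
    · rw [reach_of_inner hi] at h5
      linarith [time_lt_one (C := C) d]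
    · rw [reach_of_inner hi, C.time_symm] at h6
      linarith

variable (C) in
def vertexRegion (v : V) : Set (ℝ × ℝ) :=
  {p | ∃ d : G.Dart, d.fst = v ∧ p ∈ C.curve d '' Icc 0 (C.reach d)}

variable (C) in
def crossingRegion (x : ℝ × ℝ) : Set (ℝ × ℝ) :=
  {p | ∃ d : G.Dart, (C.Proper d ∧ C.node d = x) ∧
    p ∈ C.curve d '' Icc (2 * C.time d / 3) (C.time d)}

lemma vertexRegion_disjoint {v w : V} (hvw : v ≠ w) :
    Disjoint (C.vertexRegion v) (C.vertexRegion w) := by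
  rw [Set.disjoint_left]
  rintro _ ⟨d, rfl, s, hs, rfl⟩ ⟨e, rfl, t, ht, heq⟩
  rcases C.eq_cases d e s t hs.1 (hs.2.trans_lt (reach_lt_one d)) ht.1
    (ht.2.trans_lt (reach_lt_one e)) heq.symm with
    ⟨-, -, h⟩ | ⟨-, -, ⟨h, -⟩ | ⟨h, h'⟩ | ⟨h, h1, h2⟩⟩
  · exact hvw h
  · exact hvw (by rw [h])
  · subst h
    have := reach_add_reach (C := C) d
    linarith [hs.2, ht.2]
  · subst h1 h2
    exact hvw ((time_le_reach hs.2).fst_eq h (time_le_reach ht.2))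

lemma vertexRegion_disjoint_crossingRegion (v : V) (x : ℝ × ℝ) :
    Disjoint (C.vertexRegion v) (C.crossingRegion x) := by
  rw [Set.disjoint_left]
  rintro _ ⟨d, rfl, s, hs, rfl⟩ ⟨e, ⟨he, rfl⟩, t, ht, heq⟩
  have h1 := C.time_pos e
  have h2 := time_lt_one (C := C) e
  rcases C.eq_cases d e s t hs.1 (hs.2.trans_lt (reach_lt_one d)) (by linarith [ht.1])
    (by linarith [ht.2]) heq.symm with
    ⟨-, h, -⟩ | ⟨-, -, ⟨h, h'⟩ | ⟨h, h'⟩ | ⟨h, k1, k2⟩⟩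
  · linarith [ht.1]
  · subst h
    have h3 := hs.2
    rw [reach_of_not_inner he.2.1] at h3
    linarith [ht.1]
  · subst h
    have h3 := hs.2
    rw [proper_symm] at he
    rw [reach_of_not_inner he.2.1] at h3
    have h4 := ht.2
    rw [C.time_symm] at h4
    linarith [C.time_pos d]
  · subst k1
    exact (he.of_cross (C.cross_comm _ _ h)).2.1 (time_le_reach hs.2)

lemma crossingRegion_disjoint {x y : ℝ × ℝ} (hxy : x ≠ y) :
    Disjoint (C.crossingRegion x) (C.crossingRegion y) := by
  rw [Set.disjoint_left]
  rintro _ ⟨d, ⟨hd, rfl⟩, s, hs, rfl⟩ ⟨e, ⟨he, rfl⟩, t, ht, heq⟩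
  have h1 := C.time_pos e
  have h2 := time_lt_one (C := C) e
  have h3 := C.time_pos d
  have h4 := time_lt_one (C := C) d
  rcases C.eq_cases d e s t (by linarith [hs.1]) (by linarith [hs.2]) (by linarith [ht.1])
    (by linarith [ht.2]) heq.symm with
    ⟨-, h, -⟩ | ⟨-, -, ⟨h, h'⟩ | ⟨h, h'⟩ | ⟨h, k1, k2⟩⟩
  · linarith [ht.1]
  · exact hxy (by rw [h])
  · exact hxy (by rw [h, node_symm])
  · exact hxy (C.curve_time _ _ h)

variable (C) in
def bridge (d : G.Dart) : Set (ℝ × ℝ) := C.curve d '' C.gap d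

lemma eq_of_bridge_inter {d e : G.Dart} (h : ¬ Disjoint (C.bridge d) (C.bridge e)) :
    e = d ∨ (e = d.symm ∧ ¬ C.Proper d) := by
  rw [Set.not_disjoint_iff] at h
  obtain ⟨_, ⟨s, hs, rfl⟩, ⟨t, ht, heq⟩⟩ := h
  have hs' := gap_bounds hs
  have ht' := gap_bounds ht
  rcases C.eq_cases d e s t hs'.1.le hs'.2 ht'.1.le ht'.2 heq.symm with
    ⟨h, -, -⟩ | ⟨-, -, ⟨h, h'⟩ | ⟨h, h'⟩ | ⟨h, k1, k2⟩⟩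
  · exact (hs'.1.ne' h).elim
  · exact Or.inl h
  · refine Or.inr ⟨h, fun hp => ?_⟩
    subst h
    rw [gap_of_proper hp] at hs
    rw [gap_of_proper hp.symm, C.time_symm] at ht
    linarith [hs.2, ht.2]
  · exact (gap_ne_time h hs k1).elim

lemma of_bridge_inter_vertexRegion {d : G.Dart} {v : V}
    (h : ¬ Disjoint (C.bridge d) (C.vertexRegion v)) : v = d.fst ∨ (v = d.snd ∧ ¬ C.Proper d) := by
  rw [Set.not_disjoint_iff] at h
  obtain ⟨_, ⟨s, hs, rfl⟩, ⟨e, rfl, t, ht, heq⟩⟩ := h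
  have hs' := gap_bounds hs
  rcases C.eq_cases d e s t hs'.1.le hs'.2 ht.1 (ht.2.trans_lt (reach_lt_one e)) heq.symm with
    ⟨h, -, -⟩ | ⟨-, -, ⟨h, h'⟩ | ⟨h, h'⟩ | ⟨h, k1, k2⟩⟩
  · exact (hs'.1.ne' h).elim
  · exact Or.inl (by rw [h])
  · refine Or.inr ⟨by rw [h]; rfl, fun hp => ?_⟩
    subst h
    rw [gap_of_proper hp] at hs
    have h3 := ht.2
    rw [reach_of_not_inner hp.2.2, C.time_symm] at h3
    linarith [hs.2, time_lt_one (C := C) d]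
  · exact (gap_ne_time h hs k1).elim

lemma of_bridge_inter_crossingRegion {d : G.Dart} {x : ℝ × ℝ}
    (h : ¬ Disjoint (C.bridge d) (C.crossingRegion x)) : C.Proper d ∧ x = C.node d := by
  rw [Set.not_disjoint_iff] at h
  obtain ⟨_, ⟨s, hs, rfl⟩, ⟨e, ⟨he, rfl⟩, t, ht, heq⟩⟩ := h
  have hs' := gap_bounds hs
  have h1 := C.time_pos e
  have h2 := time_lt_one (C := C) e
  rcases C.eq_cases d e s t hs'.1.le hs'.2 (by linarith [ht.1]) (by linarith [ht.2]) heq.symm with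
    ⟨h, -, -⟩ | ⟨-, -, ⟨h, h'⟩ | ⟨h, h'⟩ | ⟨h, k1, k2⟩⟩
  · exact (hs'.1.ne' h).elim
  · subst h; exact ⟨he, rfl⟩
  · subst h; exact ⟨proper_symm.1 he, node_symm d⟩
  · exact (gap_ne_time h hs k1).elim

lemma isCompact_image {d : G.Dart} {a b : ℝ} (ha : 0 ≤ a) (hb : b ≤ 1) :
    IsCompact (C.curve d '' Icc a b) :=
  isCompact_Icc.image_of_continuousOn ((C.continuousOn d).mono (Icc_subset_Icc ha hb))

lemma isPreconnected_image {d : G.Dart} {a b : ℝ} (ha : 0 ≤ a) (hb : b ≤ 1) :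
    IsPreconnected (C.curve d '' Icc a b) :=
  isPreconnected_Icc.image _ ((C.continuousOn d).mono (Icc_subset_Icc ha hb))

lemma bridge_eq (d : G.Dart) : ∃ a b, 0 ≤ a ∧ b ≤ 1 ∧ C.bridge d = C.curve d '' Icc a b := by
  have h1 := C.time_pos d
  have h2 := time_lt_one (C := C) d
  by_cases h : C.Proper d
  · exact ⟨C.time d / 3, 2 * C.time d / 3, by linarith, by linarith,
      by rw [bridge, gap_of_proper h]⟩
  · exact ⟨C.reach d, 1 - C.reach d.symm, (reach_pos d).le, by linarith [reach_pos (C := C) d.symm],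
      by rw [bridge, gap_of_not_proper h]⟩

lemma isCompact_vertexRegion [Finite G.Dart] (v : V) : IsCompact (C.vertexRegion v) := by
  have : C.vertexRegion v =
      ⋃ d ∈ {d : G.Dart | d.fst = v}, C.curve d '' Icc 0 (C.reach d) := by
    ext p; simp [vertexRegion]
  rw [this]
  exact (Set.toFinite _).isCompact_biUnion fun d _ => isCompact_image le_rfl (reach_lt_one d).le

lemma isPreconnected_vertexRegion (v : V) : IsPreconnected (C.vertexRegion v) := by
  by_cases hv : ∃ d : G.Dart, d.fst = v
  · obtain ⟨d0, hd0⟩ := hv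
    refine isPreconnected_of_forall (C.curve d0 0) ?_
    rintro p ⟨d, hd, hp⟩
    refine ⟨C.curve d '' Icc 0 (C.reach d), fun q hq => ⟨d, hd, hq⟩, ?_, hp,
      isPreconnected_image le_rfl (reach_lt_one d).le⟩
    exact ⟨0, ⟨le_rfl, (reach_pos d).le⟩, C.curve_zero _ _ (hd.trans hd0.symm)⟩
  · have : C.vertexRegion v = ∅ := by
      ext p
      simp only [vertexRegion, mem_ofPred_eq, mem_empty_iff_false, iff_false]
      rintro ⟨d, hd, -⟩
      exact hv ⟨d, hd⟩
    rw [this]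
    exact isPreconnected_empty

lemma isCompact_crossingRegion [Finite G.Dart] (x : ℝ × ℝ) : IsCompact (C.crossingRegion x) := by
  have : C.crossingRegion x = ⋃ d ∈ {d : G.Dart | C.Proper d ∧ C.node d = x},
      C.curve d '' Icc (2 * C.time d / 3) (C.time d) := by
    ext p; simp [crossingRegion]
  rw [this]
  exact (Set.toFinite _).isCompact_biUnion fun d _ =>
    isCompact_image (by linarith [C.time_pos d]) (time_lt_one d).le

lemma isPreconnected_crossingRegion (x : ℝ × ℝ) : IsPreconnected (C.crossingRegion x) := by
  refine isPreconnected_of_forall x ?_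
  rintro p ⟨d, hd, hp⟩
  refine ⟨C.curve d '' Icc (2 * C.time d / 3) (C.time d), fun q hq => ⟨d, hd, hq⟩, ?_, hp,
      isPreconnected_image (by linarith [C.time_pos d]) (time_lt_one d).le⟩
  exact ⟨C.time d, ⟨by linarith [C.time_pos d], le_rfl⟩, hd.2⟩

end DartCurves

/-- The darts of the planarization of `G`, in which the darts satisfying `c` are subdivided at their
crossing: `inl d` starts at the tail of `d`, and `inr d` at the crossing on `d`, towards the tail
of `d`. -/
abbrev PlanDart {V : Type*} (G : SimpleGraph V) (c : G.Dart → Prop) := G.Dart ⊕ {d // c d}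

section PlanDart
variable {V : Type*} {G : SimpleGraph V} (c : G.Dart → Prop)

open Classical in
noncomputable def planFlipFun : PlanDart G c → PlanDart G c
  | Sum.inl d => if h : c d then Sum.inr ⟨d, h⟩ else Sum.inl d.symm
  | Sum.inr d => Sum.inl d.1

/-- Tails of the darts of the planarization. -/
def planTail {N : Type*} (node : G.Dart → N) : PlanDart G c → V ⊕ N :=
  Sum.map (fun d => d.fst) (fun d => node d.1)

variable {c}

lemma planFlipFun_involutive (hc : ∀ d, c d.symm ↔ c d) :
    Function.Involutive (planFlipFun c) := by
  rintro (d | ⟨d, hd⟩)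
  · by_cases h : c d
    · simp [planFlipFun, h]
    · simp [planFlipFun, h, hc]
  · simp [planFlipFun, hd]

/-- Reversal of the darts of the planarization. -/
noncomputable def planFlip (hc : ∀ d, c d.symm ↔ c d) : Perm (PlanDart G c) :=
  (planFlipFun_involutive hc).toPerm

lemma planFlip_apply_inl_of (hc : ∀ d, c d.symm ↔ c d) {d : G.Dart} (h : c d) :
    planFlip hc (Sum.inl d) = Sum.inr ⟨d, h⟩ := dif_pos h

lemma planFlip_apply_inl_of_not (hc : ∀ d, c d.symm ↔ c d) {d : G.Dart} (h : ¬ c d) :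
    planFlip hc (Sum.inl d) = Sum.inl d.symm := dif_neg h

lemma planFlip_apply_inr (hc : ∀ d, c d.symm ↔ c d) (d : {d // c d}) :
    planFlip hc (Sum.inr d) = Sum.inl d.1 := rfl

lemma planFlip_planFlip (hc : ∀ d, c d.symm ↔ c d) (a : PlanDart G c) :
    planFlip hc (planFlip hc a) = a :=
  planFlipFun_involutive hc a

end PlanDart

namespace DartCurves
variable {V : Type*} {G : SimpleGraph V} {C : DartCurves G}

lemma bridge_symm {d : G.Dart} (h : ¬ C.Proper d) : C.bridge d.symm = C.bridge d := by
  have key : ∀ d, ¬ C.Proper d → C.bridge d.symm ⊆ C.bridge d := by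
    rintro d h _ ⟨s, hs, rfl⟩
    rw [gap_of_not_proper (mt proper_symm.1 h), d.symm_symm] at hs
    refine ⟨1 - s, ?_, (C.curve_symm d s).symm⟩
    rw [gap_of_not_proper h]
    constructor <;> linarith [hs.1, hs.2]
  refine (key d h).antisymm ?_
  simpa using key d.symm (mt proper_symm.1 h)

theorem isSpherical [Finite G.Dart] (C : DartCurves G) :
    IsSpherical (planFlip (c := C.Proper) fun _ => proper_symm) (planTail C.Proper C.node) := by
  set α := planFlip (c := C.Proper) fun _ => proper_symm with hα
  have hl : ∀ d (h : C.Proper d), α (Sum.inl d) = Sum.inr ⟨d, h⟩ :=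
    fun d h => planFlip_apply_inl_of _ h
  have hl' : ∀ d (h : ¬ C.Proper d), α (Sum.inl d) = Sum.inl d.symm :=
    fun d h => planFlip_apply_inl_of_not _ h
  have hr : ∀ d : {d // C.Proper d}, α (Sum.inr d) = Sum.inl d.1 :=
    fun d => planFlip_apply_inr _ d
  refine isSpherical_of_continua (K := Sum.elim C.vertexRegion C.crossingRegion)
    (M := Sum.elim C.bridge fun d => C.bridge d.1) (planFlip_planFlip _) ?_ ?_ ?_ ?_ ?_ ?_ ?_ ?_ ?_ ?_
  · rintro (d | d)
    · by_cases h : C.Proper d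
      · rw [hl d h]; simp [planTail]
      · rw [hl' d h]; simp [planTail]
    · rw [hr]; simp [planTail]
  · rintro (d | d)
    · exact isCompact_vertexRegion _
    · exact isCompact_crossingRegion _
  · rintro (d | d)
    · exact isPreconnected_vertexRegion _
    · exact isPreconnected_crossingRegion _
  · rintro (d | d)
    · obtain ⟨a, b, ha, hb, h⟩ := bridge_eq (C := C) d
      simpa [h] using isCompact_image ha hb
    · obtain ⟨a, b, ha, hb, h⟩ := bridge_eq (C := C) d.1
      simpa [h] using isCompact_image ha hb
  · rintro (d | d)
    · obtain ⟨a, b, ha, hb, h⟩ := bridge_eq (C := C) d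
      simpa [h] using isPreconnected_image ha hb
    · obtain ⟨a, b, ha, hb, h⟩ := bridge_eq (C := C) d.1
      simpa [h] using isPreconnected_image ha hb
  · rintro (d | d)
    · by_cases h : C.Proper d
      · rw [hl d h]; rfl
      · rw [hl' d h]; exact bridge_symm h
    · rw [hr]; rfl
  · rintro (d | d) (e | e) h
    · exact vertexRegion_disjoint fun h' => h (congrArg Sum.inl h')
    · exact vertexRegion_disjoint_crossingRegion _ _
    · exact (vertexRegion_disjoint_crossingRegion _ _).symm
    · exact crossingRegion_disjoint fun h' => h (congrArg Sum.inr h')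
  · rintro (d | d) (e | e) h1 h2
    · by_contra h
      rcases eq_of_bridge_inter h with rfl | ⟨rfl, h'⟩
      · exact h1 rfl
      · exact h2 (hl' d h').symm
    · by_contra h
      rcases eq_of_bridge_inter h with h3 | ⟨h3, h'⟩
      · refine h2 ?_
        subst h3
        exact (hl _ e.2).symm
      · exact h' (proper_symm.1 (h3 ▸ e.2))
    · by_contra h
      rcases eq_of_bridge_inter h with rfl | ⟨rfl, h'⟩
      · exact h2 (hr d).symm
      · exact h' d.2
    · by_contra h
      rcases eq_of_bridge_inter h with h3 | ⟨h3, h'⟩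
      · exact h1 (congrArg Sum.inr (Subtype.ext h3))
      · exact h' d.2
  · rintro (d | d)
    · have h1 := C.time_pos d
      have h2 := reach_add_reach (C := C) d
      refine ⟨C.curve d (C.reach d), ⟨_, ?_, rfl⟩, d, rfl, _, ⟨(reach_pos d).le, le_rfl⟩, rfl⟩
      by_cases h : C.Proper d
      · rw [gap_of_proper h, reach_of_not_inner h.2.1]
        constructor <;> linarith
      · rw [gap_of_not_proper h]
        constructor <;> linarith
    · have h1 := C.time_pos d.1
      refine ⟨C.curve d.1 (2 * C.time d.1 / 3), ⟨_, ?_, rfl⟩, d.1, ⟨d.2, rfl⟩, _, ⟨le_rfl, ?_⟩, rfl⟩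
      · rw [gap_of_proper d.2]
        constructor <;> linarith
      · linarith
  · have key : ∀ (d : G.Dart) (e : PlanDart G C.Proper),
        planTail C.Proper C.node e ≠ Sum.inl d.fst →
        (C.Proper d → planTail C.Proper C.node e ≠ Sum.inr (C.node d)) →
        (¬ C.Proper d → planTail C.Proper C.node e ≠ Sum.inl d.snd) →
        Disjoint (C.bridge d) (Sum.elim C.vertexRegion C.crossingRegion
          (planTail C.Proper C.node e)) := by
      rintro d (e | e) h1 h2 h3
      · by_contra h
        rcases of_bridge_inter_vertexRegion h with h' | ⟨h', hp⟩
        · exact h1 (congrArg Sum.inl h')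
        · exact h3 hp (congrArg Sum.inl h')
      · by_contra h
        obtain ⟨hp, h'⟩ := of_bridge_inter_crossingRegion h
        exact h2 hp (congrArg Sum.inr h')
    rintro (d | d) e h1 h2
    · refine key d e h1 (fun hp => ?_) fun hp => ?_
      · rwa [hl d hp] at h2
      · rwa [hl' d hp] at h2
    · rw [hr] at h2
      exact key d.1 e h2 (fun _ => h1) fun hp => (hp d.2).elim

end DartCurves

end PermOrbit

namespace PermOrbit

open Equiv

lemma minimalPeriod_eq_card [Finite D] {π : Perm D} {x : D} {S : Finset D}
    (hS : ∀ y, y ∈ S ↔ π.SameCycle x y) : Function.minimalPeriod π x = S.card := by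
  classical
  have hper : x ∈ Function.periodicPts π :=
    Function.mem_periodicPts.2 (π.injective.mem_periodicPts x)
  have : S = (Finset.range (Function.minimalPeriod π x)).image fun i => π^[i] x := by
    ext y
    rw [hS, Finset.mem_image]
    constructor
    · intro h
      obtain ⟨i, hi⟩ := h.exists_nat_pow_eq
      refine ⟨i % Function.minimalPeriod π x, Finset.mem_range.2 (Nat.mod_lt _
        (Function.minimalPeriod_pos_of_mem_periodicPts hper)), ?_⟩
      rw [Function.iterate_mod_minimalPeriod_eq, ← hi, Perm.iterate_eq_pow]
    · rintro ⟨i, -, rfl⟩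
      exact ⟨i, by simp [Perm.iterate_eq_pow]⟩
  rw [this, Finset.card_image_of_injOn, Finset.card_range]
  intro i hi j hj h
  exact Function.iterate_injOn_Iio_minimalPeriod (Finset.mem_range.1 hi) (Finset.mem_range.1 hj) h

/-- Weighted orbit counting. -/
lemma mul_numOrbits_le [Fintype D] {π : Perm D} {w : D → ℚ} {m : ℚ} (hw : ∀ x, 0 ≤ w x)
    (h : ∀ x, ∃ s : Finset D, (∀ y ∈ s, π.SameCycle x y) ∧ m ≤ ∑ y ∈ s, w y) :
    m * numOrbits (cyc π) ≤ ∑ x, w x := by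
  classical
  have : Fintype (Quotient (cyc π)) := Fintype.ofFinite _
  rw [numOrbits, Nat.card_eq_fintype_card,
    ← Finset.sum_fiberwise (s := Finset.univ) (g := fun x => (Quotient.mk (cyc π) x)) (f := w)]
  rw [mul_comm, ← nsmul_eq_mul]
  refine Finset.card_nsmul_le_sum _ _ _ fun q _ => ?_
  induction q using Quotient.inductionOn with | _ x =>
  obtain ⟨s, hs, hm⟩ := h x
  refine hm.trans (Finset.sum_le_sum_of_subset_of_nonneg (fun y hy => ?_) fun y _ _ => hw y)
  exact Finset.mem_filter.2 ⟨Finset.mem_univ _, Quotient.sound (s := cyc π) (hs y hy).symm⟩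

/-- A rotation system of the planarization of `G` drawn in the sphere with some darts crossed in
pairs. -/
structure CrossedRotation {V : Type*} (G : SimpleGraph V) where
  /-- The darts whose edge is crossed. -/
  crossed : G.Dart → Prop
  crossed_symm : ∀ d, crossed d.symm ↔ crossed d
  /-- The rotation around the vertices. -/
  rot : Perm G.Dart
  sameCycle_rot : ∀ d e, rot.SameCycle d e ↔ d.fst = e.fst
  /-- The rotation around the crossings. -/
  turn : Perm G.Dart
  crossed_turn : ∀ d, crossed (turn d) ↔ crossed d
  turn_four : ∀ d, crossed d → turn (turn (turn (turn d))) = d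
  turn_two_ne : ∀ d, crossed d → turn (turn d) ≠ d
  turn_symm : ∀ d, crossed d → d.symm = turn d ∨ d.symm = turn (turn d) ∨
    d.symm = turn (turn (turn d))
  turn_fst : ∀ d, crossed d → (turn d).fst ≠ d.fst
  euler : eulerDefect (Perm.sumCongr rot (turn.subtypePerm crossed_turn)) (planFlip crossed_symm)
    ≤ 0

theorem DartCurves.exists_crossedRotation {V : Type*} {G : SimpleGraph V} [Finite G.Dart]
    (C : DartCurves G) : Nonempty (CrossedRotation G) := by
  classical
  obtain ⟨σ, hσ, hE⟩ := C.isSpherical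
  have hmaps : Set.MapsTo σ (Set.range Sum.inl) (Set.range Sum.inl) := by
    rintro _ ⟨d, rfl⟩
    have h := (hσ (Sum.inl d) (σ (Sum.inl d))).1
      (Perm.sameCycle_apply_right.2 (Perm.SameCycle.refl _ _))
    rcases hx : σ (Sum.inl d) with e | e
    · exact ⟨e, rfl⟩
    · rw [hx] at h; simp [planTail] at h
  obtain ⟨⟨ρ, τ⟩, rfl⟩ := Perm.mem_sumCongrHom_range_of_perm_mapsTo_inl hmaps
  have hpow : ∀ (n : ℤ), (Perm.sumCongrHom _ _ (ρ, τ)) ^ n = Perm.sumCongr (ρ ^ n) (τ ^ n) :=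
    fun n => by rw [← map_zpow]; rfl
  have hρ : ∀ d e, ρ.SameCycle d e ↔ d.fst = e.fst := by
    intro d e
    have := hσ (Sum.inl d) (Sum.inl e)
    simp only [Perm.SameCycle, hpow] at this
    simpa [Perm.SameCycle, planTail] using this
  have hτ : ∀ d e, τ.SameCycle d e ↔ C.node d.1 = C.node e.1 := by
    intro d e
    have := hσ (Sum.inr d) (Sum.inr e)
    simp only [Perm.SameCycle, hpow] at this
    simpa [Perm.SameCycle, planTail] using this
  let T : Perm G.Dart := Perm.ofSubtype τ
  have hT : ∀ d (h : C.Proper d), T d = τ ⟨d, h⟩ := fun d h => Perm.ofSubtype_apply_of_mem _ h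
  have hTc : ∀ d, C.Proper (T d) ↔ C.Proper d := fun d =>
    Perm.ofSubtype_apply_mem_iff_mem τ d
  have hTn : ∀ d, C.Proper d → C.node (T d) = C.node d := by
    intro d h
    rw [hT d h]
    exact ((hτ ⟨d, h⟩ _).1 (Perm.sameCycle_apply_right.2 (Perm.SameCycle.refl _ _))).symm
  have key : ∀ d, C.Proper d → T (T (T (T d))) = d ∧ T (T d) ≠ d ∧ T d ≠ d ∧
      (∀ f, C.Proper f → C.node f = C.node d → f = d ∨ f = T d ∨ f = T (T d) ∨ f = T (T (T d))) := by
    intro d hd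
    obtain ⟨e, he, h1, h2, h3, h4, hn, hf⟩ := hd.exists_partner
    let S : Finset {d // C.Proper d} := {⟨d, hd⟩, ⟨d.symm, hd.symm⟩, ⟨e, he⟩, ⟨e.symm, he.symm⟩}
    have hS : ∀ y, y ∈ S ↔ τ.SameCycle ⟨d, hd⟩ y := by
      intro y
      rw [hτ]
      simp only [S, Finset.mem_insert, Finset.mem_singleton, Subtype.ext_iff]
      constructor
      · rintro (h | h | h | h) <;> rw [h]
        · rw [C.node_symm]
        · exact hn.symm
        · rw [C.node_symm, hn]
      · exact fun h => hf _ h.symm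
    have hcard : S.card = 4 := by
      have n1 : d ≠ d.symm := d.symm_ne.symm
      have n2 : d ≠ e := by rintro rfl; exact h1 rfl
      have n3 : d ≠ e.symm := by rintro rfl; exact h3 rfl
      have n4 : d.symm ≠ e := by rintro rfl; exact h2 rfl
      have n5 : d.symm ≠ e.symm := by
        intro h; exact n2 (SimpleGraph.Dart.symm_involutive.injective h)
      have n6 : e ≠ e.symm := e.symm_ne.symm
      simp [S, n1, n2, n3, n4, n5, n6]
    have hp : Function.minimalPeriod τ ⟨d, hd⟩ = 4 := by rw [minimalPeriod_eq_card hS, hcard]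
    have hcoe : ∀ n : ℕ, ((τ^[n] ⟨d, hd⟩ : {d // C.Proper d}) : G.Dart) = T^[n] d := by
      intro n
      induction n with
      | zero => rfl
      | succ n ih =>
        rw [Function.iterate_succ_apply', Function.iterate_succ_apply', ← ih,
          hT _ (τ^[n] ⟨d, hd⟩).2]
    have hper : ∀ n : ℕ, T^[n] d = d ↔ 4 ∣ n := by
      intro n
      rw [← hp, ← Function.isPeriodicPt_iff_minimalPeriod_dvd, Function.IsPeriodicPt,
        Function.IsFixedPt, ← hcoe, Subtype.ext_iff]
    refine ⟨(hper 4).2 (by norm_num), mt (hper 2).1 (by norm_num), mt (hper 1).1 (by norm_num),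
      fun f hfp hfn => ?_⟩
    obtain ⟨i, hi⟩ := ((hτ ⟨d, hd⟩ ⟨f, hfp⟩).2 hfn.symm).exists_nat_pow_eq
    rw [← Perm.iterate_eq_pow, ← Function.iterate_mod_minimalPeriod_eq, hp] at hi
    have hi' := congrArg Subtype.val hi
    rw [hcoe] at hi'
    have := Nat.mod_lt i (show 0 < 4 by norm_num)
    interval_cases i % 4
    · exact Or.inl hi'.symm
    · exact Or.inr (Or.inl hi'.symm)
    · exact Or.inr (Or.inr (Or.inl hi'.symm))
    · exact Or.inr (Or.inr (Or.inr hi'.symm))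
  refine ⟨⟨C.Proper, fun _ => proper_symm, ρ, hρ, T, hTc, fun d h => (key d h).1,
    fun d h => (key d h).2.1, fun d h => ?_, fun d h hfst => ?_, ?_⟩⟩
  · rcases (key d h).2.2.2 _ h.symm (node_symm d) with h' | h'
    · exact (d.symm_ne h').elim
    · exact h'
  · obtain ⟨e, he, h1, h2, h3, h4, hn, hf⟩ := h.exists_partner
    rcases hf _ (hTn d h) with h' | h' | h' | h'
    · exact (key d h).2.2.1 h'
    · rw [h'] at hfst; exact d.fst_ne_snd hfst.symm
    · rw [h'] at hfst; exact h1 hfst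
    · rw [h'] at hfst; exact h3 hfst
  · have : T.subtypePerm hTc = τ :=
      Equiv.ext fun d => Subtype.ext (hT d d.2)
    rw [this]
    exact hE

end PermOrbit

namespace PermOrbit

open Equiv

namespace CrossedRotation
variable {V : Type*} {G : SimpleGraph V} (C : CrossedRotation G)

lemma eq_of_ends {d e : G.Dart} (h : d.fst = e.fst) (h' : d.snd = e.snd) : d = e := by
  ext <;> assumption

lemma rot_fst (e : G.Dart) : (C.rot e).fst = e.fst :=
  ((C.sameCycle_rot _ _).1 (Perm.sameCycle_apply_right.2 (Perm.SameCycle.refl _ _))).symm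

lemma rot_symm_fst (e : G.Dart) : (C.rot.symm e).fst = e.fst := by
  simpa using (C.rot_fst (C.rot.symm e)).symm

/-- The face permutation of the planarization. -/
noncomputable def face : Perm (PlanDart G C.crossed) :=
  Perm.sumCongr C.rot (C.turn.subtypePerm C.crossed_turn) * planFlip C.crossed_symm

lemma face_inl_of {e : G.Dart} (h : C.crossed e) :
    C.face (Sum.inl e) = Sum.inr ⟨C.turn e, (C.crossed_turn e).2 h⟩ := by
  rw [face, Perm.mul_apply, planFlip_apply_inl_of _ h]
  rfl

lemma face_inl_of_not {e : G.Dart} (h : ¬ C.crossed e) :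
    C.face (Sum.inl e) = Sum.inl (C.rot e.symm) := by
  rw [face, Perm.mul_apply, planFlip_apply_inl_of_not _ h]
  rfl

lemma face_inr (e : {e // C.crossed e}) : C.face (Sum.inr e) = Sum.inl (C.rot e.1) := by
  rw [face, Perm.mul_apply, planFlip_apply_inr]
  rfl

/-- The corner between `C.rot.symm e` and `e` belongs to a triangular face of the planarization. -/
def Tri (e : G.Dart) : Prop := C.face (C.face (C.face (Sum.inl e))) = Sum.inl e

/-- The corner between `C.rot.symm e` and `e` belongs to a triangular face of the planarization
that is bounded by three uncrossed edges. -/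
def Full (e : G.Dart) : Prop := C.Tri e ∧ ¬ C.crossed e ∧ ¬ C.crossed (C.rot.symm e)

variable {C}

lemma Tri.cases {e : G.Dart} (h : C.Tri e) :
    (¬ C.crossed e ∧ ¬ C.crossed (C.rot.symm e) ∧ ¬ C.crossed (C.rot e.symm) ∧
      C.rot (C.rot e.symm).symm = (C.rot.symm e).symm) ∨
    (C.crossed e ∧ ¬ C.crossed (C.rot.symm e) ∧ C.rot (C.turn e) = (C.rot.symm e).symm) ∨
    (¬ C.crossed e ∧ C.crossed (C.rot.symm e) ∧ C.crossed (C.rot e.symm) ∧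
      C.turn (C.rot e.symm) = C.rot.symm e) := by
  unfold Tri at h
  by_cases he : C.crossed e
  · rw [C.face_inl_of he, C.face_inr] at h
    by_cases hg : C.crossed (C.rot (C.turn e))
    · rw [C.face_inl_of hg] at h; simp at h
    · rw [C.face_inl_of_not hg] at h
      have h1 : C.rot.symm e = (C.rot (C.turn e)).symm := by
        nth_rw 1 [← Sum.inl.inj h]; simp
      refine Or.inr (Or.inl ⟨he, ?_, by rw [h1]; simp⟩)
      rwa [h1, C.crossed_symm]
  · rw [C.face_inl_of_not he] at h
    by_cases hg : C.crossed (C.rot e.symm)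
    · rw [C.face_inl_of hg, C.face_inr] at h
      have h1 : C.rot.symm e = C.turn (C.rot e.symm) := by
        nth_rw 1 [← Sum.inl.inj h]; simp
      refine Or.inr (Or.inr ⟨he, ?_, hg, h1.symm⟩)
      rwa [h1, C.crossed_turn]
    · rw [C.face_inl_of_not hg] at h
      by_cases hk : C.crossed (C.rot (C.rot e.symm).symm)
      · rw [C.face_inl_of hk] at h; simp at h
      · rw [C.face_inl_of_not hk] at h
        have h1 : C.rot.symm e = (C.rot (C.rot e.symm).symm).symm := by
          nth_rw 1 [← Sum.inl.inj h]; simp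
        refine Or.inl ⟨he, ?_, hg, by rw [h1]; simp⟩
        rwa [h1, C.crossed_symm]

variable (C) in
open Classical in
/-- The share of a corner in the excess of its face. -/
noncomputable def weight (e : G.Dart) : ℤ :=
  if C.Tri e then (if C.Full e then 1 else 0) else 3

lemma weight_of_not_tri {e : G.Dart} (h : ¬ C.Tri e) : C.weight e = 3 := if_neg h

lemma weight_of_full {e : G.Dart} (h : C.Full e) : C.weight e = 1 := by
  simp [weight, h, h.1]

lemma weight_of_tri {e : G.Dart} (h : C.Tri e) (h' : ¬ C.Full e) : C.weight e = 0 := by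
  simp [weight, h, h']

lemma weight_le (e : G.Dart) : C.weight e ≤ 3 := by
  unfold weight; split_ifs <;> norm_num

lemma weight_le_one {e : G.Dart} (h : C.Tri e) : C.weight e ≤ 1 := by
  rw [weight, if_pos h]; split_ifs <;> norm_num

lemma face_ne (x : PlanDart G C.crossed) : C.face x ≠ x := by
  rcases x with e | e
  · by_cases h : C.crossed e
    · rw [C.face_inl_of h]; simp
    · rw [C.face_inl_of_not h]
      intro h'
      have := congrArg (fun d => d.fst) (Sum.inl.inj h')
      rw [C.rot_fst] at this
      exact e.fst_ne_snd this.symm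
  · rw [C.face_inr]; simp

/-- Faces of size three have total weight eight. -/
lemma eight_le_of_tri {w : PlanDart G C.crossed → ℚ}
    (hl : ∀ e, w (Sum.inl e) = 3 - C.weight e / 3) (hr : ∀ e, w (Sum.inr e) = 2)
    {e : G.Dart} (h : C.Tri e) :
    8 ≤ w (Sum.inl e) + w (C.face (Sum.inl e)) + w (C.face (C.face (Sum.inl e))) := by
  have h1 : ∀ {e}, C.Tri e → (8 / 3 : ℚ) ≤ w (Sum.inl e) := by
    intro e he
    rw [hl]
    have : (C.weight e : ℚ) ≤ 1 := by exact_mod_cast weight_le_one he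
    linarith
  have h0 : ∀ {e}, C.Tri e → ¬ C.Full e → w (Sum.inl e) = 3 := by
    intro e he he'
    rw [hl, weight_of_tri he he']
    norm_num
  by_cases he : C.crossed e
  · have h2 : C.Tri (C.rot (C.turn e)) := by
      unfold Tri at h ⊢
      rw [C.face_inl_of he, C.face_inr] at h
      rw [h, C.face_inl_of he, C.face_inr]
    rw [C.face_inl_of he, C.face_inr, hr, h0 h fun hf => hf.2.1 he, h0 h2 fun hf => hf.2.2 ?_]
    · norm_num
    · simpa [C.crossed_turn] using he
  · have h2 := h
    unfold Tri at h2
    rw [C.face_inl_of_not he] at h2 ⊢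
    have hg' : C.Tri (C.rot e.symm) := by
      unfold Tri
      rw [h2, C.face_inl_of_not he]
    by_cases hg : C.crossed (C.rot e.symm)
    · rw [C.face_inl_of hg, hr, h0 hg' fun hf => hf.2.1 hg, h0 h fun hf => hf.2.2 ?_]
      · norm_num
      · rcases h.cases with h3 | h3 | h3
        · exact (h3.2.2.1 hg).elim
        · exact (he h3.1).elim
        · exact h3.2.1
    · rw [C.face_inl_of_not hg] at h2 ⊢
      have hk' : C.Tri (C.rot (C.rot e.symm).symm) := by
        unfold Tri
        rw [h2, C.face_inl_of_not he, C.face_inl_of_not hg]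
      linarith [h1 h, h1 hg', h1 hk']

section Finite
variable [Fintype V] [DecidableRel G.Adj]

lemma iterate_rot_eq_iff (e : G.Dart) (n : ℕ) :
    C.rot^[n] e = e ↔ G.degree e.fst ∣ n := by
  classical
  have : Function.minimalPeriod C.rot e = G.degree e.fst := by
    rw [← G.dart_fst_fiber_card_eq_degree]
    refine minimalPeriod_eq_card fun y => ?_
    rw [C.sameCycle_rot, Finset.mem_filter]
    simp [eq_comm]
  rw [← this, ← Function.isPeriodicPt_iff_minimalPeriod_dvd]
  rfl

lemma face_face_inl_ne (hdeg : ∀ v, 7 ≤ G.degree v) (e : G.Dart) :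
    C.face (C.face (Sum.inl e)) ≠ Sum.inl e := by
  by_cases h : C.crossed e
  · rw [C.face_inl_of h, C.face_inr]
    intro h'
    have := congrArg (fun d => d.fst) (Sum.inl.inj h')
    dsimp only at this
    rw [C.rot_fst] at this
    exact C.turn_fst e h this
  · rw [C.face_inl_of_not h]
    by_cases hg : C.crossed (C.rot e.symm)
    · rw [C.face_inl_of hg]; simp
    · rw [C.face_inl_of_not hg]
      intro h'
      have h1 := Sum.inl.inj h'
      have h2 : (C.rot e.symm).symm = e := by
        refine eq_of_ends ?_ ?_
        · rw [← C.rot_fst, h1]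
        · exact C.rot_fst e.symm
      rw [h2] at h1
      have := (iterate_rot_eq_iff e 1).1 h1
      have := Nat.le_of_dvd one_pos this
      have := hdeg e.fst
      omega

lemma eight_mul_faces_le (hdeg : ∀ v, 7 ≤ G.degree v) [Fintype {e // C.crossed e}] :
    8 * (numOrbits (cyc C.face) : ℚ) ≤
      3 * Fintype.card G.Dart - (∑ e, (C.weight e : ℚ)) / 3 + 2 * Fintype.card {e // C.crossed e} := by
  classical
  let w : PlanDart G C.crossed → ℚ := Sum.elim (fun e => 3 - C.weight e / 3) fun _ => 2
  have hw2 : ∀ x, 2 ≤ w x := by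
    rintro (e | e)
    · have : (C.weight e : ℚ) ≤ 3 := by exact_mod_cast weight_le e
      change (2 : ℚ) ≤ 3 - C.weight e / 3
      linarith
    · exact le_rfl
  have hS : ∀ (x) (n : ℕ), C.face.SameCycle x (C.face^[n] x) := fun x n =>
    ⟨n, by simp [Perm.iterate_eq_pow]⟩
  have key : ∀ e, ∃ s : Finset (PlanDart G C.crossed),
      (∀ y ∈ s, C.face.SameCycle (Sum.inl e) y) ∧ 8 ≤ ∑ y ∈ s, w y := by
    intro e
    have h1 := face_ne (C := C) (Sum.inl e)
    have h2 := face_face_inl_ne (C := C) hdeg e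
    have h1' : C.face (C.face (Sum.inl e)) ≠ C.face (Sum.inl e) := face_ne _
    have h1'' : C.face (C.face (C.face (Sum.inl e))) ≠ C.face (C.face (Sum.inl e)) := face_ne _
    by_cases h : C.Tri e
    · refine ⟨{Sum.inl e, C.face (Sum.inl e), C.face (C.face (Sum.inl e))}, ?_, ?_⟩
      · intro y hy
        simp only [Finset.mem_insert, Finset.mem_singleton] at hy
        rcases hy with rfl | rfl | rfl
        exacts [hS _ 0, hS _ 1, hS _ 2]
      · rw [Finset.sum_insert (by simp [h1.symm, h2.symm]), Finset.sum_pair h1'.symm, ← add_assoc]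
        exact eight_le_of_tri (fun _ => rfl) (fun _ => rfl) h
    · have h3 : C.face (C.face (C.face (Sum.inl e))) ≠ Sum.inl e := h
      have h4 : C.face (C.face (C.face (Sum.inl e))) ≠ C.face (Sum.inl e) := fun h' =>
        h2 (C.face.injective h')
      refine ⟨{Sum.inl e, C.face (Sum.inl e), C.face (C.face (Sum.inl e)),
        C.face (C.face (C.face (Sum.inl e)))}, ?_, ?_⟩
      · intro y hy
        simp only [Finset.mem_insert, Finset.mem_singleton] at hy
        rcases hy with rfl | rfl | rfl | rfl
        exacts [hS _ 0, hS _ 1, hS _ 2, hS _ 3]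
      · rw [Finset.sum_insert (by simp [h1.symm, h2.symm, h3.symm]),
          Finset.sum_insert (by simp [h1'.symm, h4.symm]), Finset.sum_pair h1''.symm]
        linarith [hw2 (Sum.inl e), hw2 (C.face (Sum.inl e)), hw2 (C.face (C.face (Sum.inl e))),
          hw2 (C.face (C.face (C.face (Sum.inl e))))]
  have := mul_numOrbits_le (π := C.face) (w := w) (m := 8) (fun x => by linarith [hw2 x]) ?_
  · refine this.trans_eq ?_
    rw [Fintype.sum_sum_type]
    simp only [w, Sum.elim_inl, Sum.elim_inr, Finset.sum_sub_distrib, Finset.sum_const,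
      Finset.card_univ, nsmul_eq_mul, Finset.sum_div]
    ring
  · rintro (e | e)
    · exact key e
    · obtain ⟨s, hs, h⟩ := key (C.rot e.1)
      refine ⟨s, fun y hy => ?_, h⟩
      rw [← Perm.sameCycle_apply_left, C.face_inr]
      exact hs y hy

lemma numOrbits_sumCongr_le (hdeg : ∀ v, 7 ≤ G.degree v) [Fintype {e // C.crossed e}] :
    (numOrbits (cyc (Perm.sumCongr C.rot (C.turn.subtypePerm C.crossed_turn))) : ℚ) ≤
      Fintype.card V + Fintype.card {e // C.crossed e} / 4 := by
  classical
  set σ := Perm.sumCongr C.rot (C.turn.subtypePerm C.crossed_turn) with hσ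
  have hpow : ∀ (n : ℤ), σ ^ n =
      Perm.sumCongr (C.rot ^ n) ((C.turn.subtypePerm C.crossed_turn) ^ n) := fun n => by
    have : σ = Perm.sumCongrHom _ _ (C.rot, C.turn.subtypePerm C.crossed_turn) := rfl
    rw [this, ← map_zpow]; rfl
  let w : PlanDart G C.crossed → ℚ := Sum.elim (fun e => 1 / G.degree e.fst) fun _ => 1 / 4
  have hpos : ∀ v, (G.degree v : ℚ) ≠ 0 := fun v => by
    have := hdeg v
    positivity
  have hfib : ∀ v, ∑ e : G.Dart with e.fst = v, (1 / G.degree e.fst : ℚ) = 1 := by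
    intro v
    rw [Finset.sum_congr rfl (g := fun _ => (1 / G.degree v : ℚ))
      (fun e he => by rw [(Finset.mem_filter.1 he).2]), Finset.sum_const,
      G.dart_fst_fiber_card_eq_degree, nsmul_eq_mul]
    have := hpos v
    field_simp
  have := mul_numOrbits_le (π := σ) (w := w) (m := 1) ?_ ?_
  · rw [one_mul] at this
    refine this.trans_eq ?_
    rw [Fintype.sum_sum_type]
    simp only [w, Sum.elim_inl, Sum.elim_inr, Finset.sum_const, Finset.card_univ, nsmul_eq_mul]
    rw [← Finset.sum_fiberwise (s := Finset.univ) (g := fun e : G.Dart => e.fst)]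
    simp only [hfib]
    simp
    ring
  · rintro (e | e)
    · exact div_nonneg zero_le_one (Nat.cast_nonneg _)
    · change (0 : ℚ) ≤ 1 / 4
      norm_num
  · rintro (e | ⟨e, he⟩)
    · refine ⟨(Finset.univ.filter fun d : G.Dart => d.fst = e.fst).map ⟨Sum.inl, Sum.inl_injective⟩,
        fun y hy => ?_, ?_⟩
      · obtain ⟨d, hd, rfl⟩ := Finset.mem_map.1 hy
        obtain ⟨i, hi⟩ := (C.sameCycle_rot e d).2 (Finset.mem_filter.1 hd).2.symm
        exact ⟨i, by rw [hpow]; simp [hi]⟩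
      · rw [Finset.sum_map]
        exact (hfib e.fst).ge
    · have hstep : ∀ (d) (h : C.crossed d), σ (Sum.inr ⟨d, h⟩) =
          Sum.inr ⟨C.turn d, (C.crossed_turn d).2 h⟩ := fun d h => rfl
      have h0 := C.turn_two_ne e he
      have h4 := C.turn_four e he
      have h1 : C.turn e ≠ e := fun h => h0 (by rw [h, h])
      have h3 : C.turn (C.turn (C.turn e)) ≠ e := fun h => h1 (by rwa [h] at h4)
      have hS : ∀ (n : ℕ), σ.SameCycle (Sum.inr ⟨e, he⟩) (σ^[n] (Sum.inr ⟨e, he⟩)) := fun n =>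
        ⟨n, by simp [Perm.iterate_eq_pow]⟩
      set x : PlanDart G C.crossed := Sum.inr ⟨e, he⟩ with hx
      refine ⟨{x, σ x, σ (σ x), σ (σ (σ x))}, fun y hy => ?_, ?_⟩
      · simp only [Finset.mem_insert, Finset.mem_singleton] at hy
        rcases hy with rfl | rfl | rfl | rfl
        exacts [hS 0, hS 1, hS 2, hS 3]
      · have k1 : σ x ≠ x := by simpa [hx, hstep] using h1
        have k2 : σ (σ x) ≠ x := by simpa [hx, hstep] using h0
        have k3 : σ (σ (σ x)) ≠ x := by simpa [hx, hstep] using h3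
        rw [Finset.sum_insert (by simp [k1.symm, k2.symm, k3.symm]),
          Finset.sum_insert (by simp [k1.symm, k2.symm]), Finset.sum_pair (by simp [k1.symm])]
        simp only [hx, hstep, w, Sum.elim_inr]
        norm_num

theorem euler_le [Nonempty G.Dart] (hdeg : ∀ v, 7 ≤ G.degree v) :
    48 ≤ ∑ v, 3 * (8 - (G.degree v : ℤ)) - ∑ e, C.weight e := by
  classical
  have hα : 2 * (numOrbits (cyc (planFlip C.crossed_symm)) : ℚ) ≤
      Fintype.card (PlanDart G C.crossed) := by
    have := mul_numOrbits_le (π := planFlip C.crossed_symm) (w := fun _ => 1) (m := 2)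
      (fun _ => zero_le_one) fun x => ⟨{x, planFlip C.crossed_symm x}, fun y hy => ?_, ?_⟩
    · simpa using this
    · simp only [Finset.mem_insert, Finset.mem_singleton] at hy
      rcases hy with rfl | rfl
      exacts [Perm.SameCycle.refl _ _, Perm.sameCycle_apply_right.2 (Perm.SameCycle.refl _ _)]
    · rw [Finset.sum_pair]
      · norm_num
      · rcases x with e | e
        · by_cases h : C.crossed e
          · rw [planFlip_apply_inl_of _ h]; simp
          · rw [planFlip_apply_inl_of_not _ h]; simpa using e.symm_ne.symm
        · rw [planFlip_apply_inr]; simp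
  have hF := eight_mul_faces_le (C := C) hdeg
  have hσ := numOrbits_sumCongr_le (C := C) hdeg
  have hE := C.euler
  have hpos : 1 ≤ numOrbits (cyc (Perm.sumCongr C.rot (C.turn.subtypePerm C.crossed_turn)) ⊔
      cyc (planFlip C.crossed_symm)) := by
    have : Nonempty (PlanDart G C.crossed) := inferInstance
    have := this.map (Quotient.mk (cyc (Perm.sumCongr C.rot (C.turn.subtypePerm C.crossed_turn)) ⊔
      cyc (planFlip C.crossed_symm)))
    exact Nat.card_pos
  unfold eulerDefect at hE
  rw [Nat.card_eq_fintype_card] at hE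
  change _ - _ - _ - (numOrbits (cyc C.face) : ℤ) ≤ 0 at hE
  have hE' : (Fintype.card (PlanDart G C.crossed) : ℚ) + 2 ≤
      numOrbits (cyc (Perm.sumCongr C.rot (C.turn.subtypePerm C.crossed_turn))) +
      numOrbits (cyc (planFlip C.crossed_symm)) + numOrbits (cyc C.face) := by
    have : (Fintype.card (PlanDart G C.crossed) : ℤ) + 2 ≤
      numOrbits (cyc (Perm.sumCongr C.rot (C.turn.subtypePerm C.crossed_turn))) +
      numOrbits (cyc (planFlip C.crossed_symm)) + numOrbits (cyc C.face) := by
      have : (1 : ℤ) ≤ numOrbits (cyc (Perm.sumCongr C.rot (C.turn.subtypePerm C.crossed_turn)) ⊔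
        cyc (planFlip C.crossed_symm)) := by exact_mod_cast hpos
      linarith
    exact_mod_cast this
  rw [Fintype.card_sum] at hα hE'
  push_cast at hα hE'
  have hdart : (Fintype.card G.Dart : ℚ) = ∑ v, (G.degree v : ℚ) := by
    rw [G.dart_card_eq_sum_degrees]; push_cast; rfl
  have hgoal : (48 : ℚ) ≤ ∑ v, 3 * (8 - (G.degree v : ℚ)) - ∑ e, (C.weight e : ℚ) := by
    rw [← Finset.mul_sum, Finset.sum_sub_distrib, ← hdart]
    simp only [Finset.sum_const, Finset.card_univ, nsmul_eq_mul]
    linarith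
  exact_mod_cast hgoal

end Finite
end CrossedRotation
end PermOrbit

namespace PermOrbit

open Equiv

namespace CrossedRotation
variable {V : Type*} {G : SimpleGraph V} {C : CrossedRotation G}

lemma Full.rot_symm {e : G.Dart} (h : C.Full e) : C.Full (C.rot e.symm) := by
  obtain ⟨ht, hc, hc'⟩ := h
  refine ⟨?_, ?_, by simpa [C.crossed_symm] using hc⟩
  · unfold Tri at ht ⊢
    rw [C.face_inl_of_not hc] at ht
    rw [ht, C.face_inl_of_not hc]
  · rcases ht.cases with h | h | h
    · exact h.2.2.1
    · exact (hc h.1).elim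
    · exact (hc' h.2.1).elim

lemma Full.rot_rot_symm {e : G.Dart} (h : C.Full e) :
    C.rot (C.rot e.symm).symm = (C.rot.symm e).symm := by
  rcases h.1.cases with h' | h' | h'
  · exact h'.2.2.2
  · exact (h.2.1 h'.1).elim
  · exact (h.2.2 h'.2.1).elim

lemma Full.symm_rot {e : G.Dart} (h : C.Full e) : C.Full (C.rot.symm e).symm :=
  h.rot_rot_symm ▸ h.rot_symm.rot_symm

lemma not_crossed_symm_rot {e : G.Dart} (h : C.Tri e) (hc : C.crossed e) :
    ¬ C.crossed (C.rot.symm e) ∧ C.rot (C.turn e) = (C.rot.symm e).symm := by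
  rcases h.cases with h' | h' | h'
  · exact (h'.1 hc).elim
  · exact h'.2
  · exact (h'.1 hc).elim

lemma not_crossed_rot {e : G.Dart} (h : C.Tri (C.rot e)) (hc : C.crossed e) :
    ¬ C.crossed (C.rot e) ∧ C.crossed (C.rot (C.rot e).symm) ∧
      C.turn (C.rot (C.rot e).symm) = e := by
  have := h.cases
  rw [Equiv.symm_apply_apply] at this
  rcases this with h' | h' | h'
  · exact (h'.2.1 hc).elim
  · exact (h'.2.1 hc).elim
  · exact ⟨h'.1, h'.2.2⟩

lemma turn_fst_eq {e : G.Dart} (h : C.Tri e) (hc : C.crossed e) :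
    (C.turn e).fst = (C.rot.symm e).snd := by
  rw [← C.rot_fst, (not_crossed_symm_rot h hc).2]
  rfl

lemma turn_turn {e : G.Dart} (h : C.Tri e) (h' : C.Tri (C.rot e)) (hc : C.crossed e) :
    C.turn (C.turn e) = e.symm ∧ (C.turn e).snd = (C.rot e).snd := by
  obtain ⟨n1, -⟩ := not_crossed_symm_rot h hc
  obtain ⟨n2, -, h2⟩ := not_crossed_rot h' hc
  have h1 := turn_fst_eq h hc
  have hfour := C.turn_four e hc
  have h3 : C.turn (C.turn (C.turn e)) = C.rot (C.rot e).symm :=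
    C.turn.injective (hfour.trans h2.symm)
  have h4 : C.turn (C.turn e) = e.symm := by
    rcases C.turn_symm e hc with k | k | k
    · rw [← k] at h1
      refine (n1 ?_).elim
      rwa [← eq_of_ends (C.rot_symm_fst e).symm h1]
    · exact k.symm
    · rw [h3] at k
      have h5 := C.rot_fst (C.rot e).symm
      rw [← k] at h5
      refine (n2 ?_).elim
      rwa [← eq_of_ends (C.rot_fst e).symm h5]
  refine ⟨h4, ?_⟩
  have key : (C.turn e).symm = C.rot (C.rot e).symm := by
    rw [← h3]
    rcases C.turn_symm _ ((C.crossed_turn e).2 hc) with k | k | k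
    · rw [h4] at k
      have := SimpleGraph.Dart.symm_involutive.injective k
      exact (C.turn_fst e hc (by rw [this])).elim
    · exact k
    · rw [hfour] at k
      have k' : C.turn e = e.symm := by rw [← SimpleGraph.Dart.symm_symm (C.turn e), k]
      exact (C.turn_fst e hc (by rw [C.turn.injective (h4.trans k'.symm)])).elim
  have := congrArg (fun d => d.fst) key
  rw [C.rot_fst] at this
  exact this

lemma adj_of_crossed {e : G.Dart} (h : C.Tri e) (h' : C.Tri (C.rot e)) (hc : C.crossed e) :
    G.Adj (C.rot.symm e).snd (C.rot e).snd := by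
  rw [← turn_fst_eq h hc, ← (turn_turn h h' hc).2]
  exact (C.turn e).adj

lemma symm_rot_symm_rot_symm {e : G.Dart} (h : C.Tri (C.rot e)) (hc : C.crossed (C.rot e)) :
    C.rot.symm e.symm = C.turn (C.rot e) := by
  have := (not_crossed_symm_rot h hc).2
  rw [Equiv.symm_apply_apply] at this
  rw [← this, Equiv.symm_apply_apply]

variable (C) in
/-- An uncrossed dart with a crossed neighbor at its tail. -/
def Slot (g : G.Dart) : Prop :=
  ¬ C.crossed g ∧ (C.crossed (C.rot.symm g) ∨ C.crossed (C.rot g))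

section Finite
variable [Fintype V] [DecidableRel G.Adj]

variable (C) in
/-- All corners at the tail of `e`, which has degree `7`, are triangular, and only one of them is
full. -/
structure Bad (e : G.Dart) : Prop where
  degree : G.degree e.fst = 7
  full : C.Full e
  tri : ∀ d : G.Dart, d.fst = e.fst → C.Tri d
  not_full : ∀ d : G.Dart, d.fst = e.fst → d ≠ e → ¬ C.Full d

namespace Bad
variable {e : G.Dart} (h : C.Bad e)
include h

lemma rot_ne : C.rot e ≠ e := by
  intro h'
  have := (C.iterate_rot_eq_iff e 1).1 h'
  rw [h.degree] at this
  omega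

lemma rot_rot_ne : C.rot (C.rot e) ≠ e := by
  intro h'
  have := (C.iterate_rot_eq_iff e 2).1 h'
  rw [h.degree] at this
  omega

lemma rot_rot_rot_ne : C.rot (C.rot (C.rot e)) ≠ e := by
  intro h'
  have := (C.iterate_rot_eq_iff e 3).1 h'
  rw [h.degree] at this
  omega

lemma iterate_five_rot_ne : C.rot (C.rot (C.rot (C.rot (C.rot e)))) ≠ e := by
  intro h'
  have := (C.iterate_rot_eq_iff e 5).1 h'
  rw [h.degree] at this
  omega

lemma crossed_iff {d : G.Dart} (hd : d.fst = e.fst) (hde : d ≠ e) :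
    C.crossed d ↔ ¬ C.crossed (C.rot.symm d) := by
  have h1 := h.tri d hd
  have h2 := h.not_full d hd hde
  constructor
  · exact fun hc => (not_crossed_symm_rot h1 hc).1
  · intro hc
    by_contra hc'
    exact h2 ⟨h1, hc', hc⟩

lemma tri_rot : C.Tri (C.rot e) := h.tri _ (C.rot_fst e)

lemma tri_rot_rot : C.Tri (C.rot (C.rot e)) := h.tri _ (by rw [C.rot_fst, C.rot_fst])

lemma tri_symm_rot : C.Tri (C.rot.symm e) := h.tri _ (C.rot_symm_fst e)

lemma tri_symm_rot_symm_rot : C.Tri (C.rot.symm (C.rot.symm e)) :=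
  h.tri _ (by rw [C.rot_symm_fst, C.rot_symm_fst])

lemma crossed_rot : C.crossed (C.rot e) := by
  rw [h.crossed_iff (C.rot_fst e) h.rot_ne, Equiv.symm_apply_apply]
  exact h.full.2.1

lemma not_crossed_rot_rot : ¬ C.crossed (C.rot (C.rot e)) :=
  (not_crossed_rot h.tri_rot_rot h.crossed_rot).1

lemma crossed_symm_rot_symm_rot : C.crossed (C.rot.symm (C.rot.symm e)) := by
  by_contra hc
  have : C.rot.symm e ≠ e := by
    rw [Ne, Equiv.symm_apply_eq]
    exact h.rot_ne.symm
  exact h.full.2.2 ((h.crossed_iff (C.rot_symm_fst e) this).2 hc)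

lemma not_crossed_symm_rot_symm_rot_symm_rot :
    ¬ C.crossed (C.rot.symm (C.rot.symm (C.rot.symm e))) :=
  (not_crossed_symm_rot h.tri_symm_rot_symm_rot h.crossed_symm_rot_symm_rot).1

lemma adj_snd_snd_symm_rot : G.Adj e.snd (C.rot.symm e).snd := by
  have h1 : (C.rot (C.rot e.symm).symm).fst = (C.rot.symm e).snd := by
    rw [h.full.rot_rot_symm]; rfl
  have h2 := (C.rot e.symm).adj
  rw [C.rot_fst] at h1 h2
  rw [← h1]
  exact h2

lemma adj_snd_snd_rot_rot : G.Adj e.snd (C.rot (C.rot e)).snd := by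
  have := adj_of_crossed h.tri_rot h.tri_rot_rot h.crossed_rot
  rwa [Equiv.symm_apply_apply] at this

lemma adj_snd_symm_rot :
    G.Adj (C.rot.symm (C.rot.symm (C.rot.symm e))).snd (C.rot.symm e).snd := by
  have := adj_of_crossed h.tri_symm_rot_symm_rot (by simpa using h.tri_symm_rot)
    h.crossed_symm_rot_symm_rot
  rwa [Equiv.apply_symm_apply] at this

lemma slot_symm : C.Slot e.symm := by
  refine ⟨by rw [C.crossed_symm]; exact h.full.2.1, Or.inl ?_⟩
  rw [symm_rot_symm_rot_symm h.tri_rot h.crossed_rot, C.crossed_turn]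
  exact h.crossed_rot

lemma slot_rot_rot_symm : C.Slot (C.rot (C.rot e)).symm :=
  ⟨by rw [C.crossed_symm]; exact h.not_crossed_rot_rot,
    Or.inr (not_crossed_rot h.tri_rot_rot h.crossed_rot).2.1⟩

lemma slot_symm_rot_symm : C.Slot (C.rot.symm e).symm := by
  refine ⟨by rw [C.crossed_symm]; exact h.full.2.2, Or.inr ?_⟩
  have := (not_crossed_rot (e := C.rot.symm (C.rot.symm e)) (by simpa using h.tri_symm_rot)
    h.crossed_symm_rot_symm_rot).2.1
  rwa [Equiv.apply_symm_apply] at this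

lemma slot_symm_rot_symm_rot_symm_rot_symm :
    C.Slot (C.rot.symm (C.rot.symm (C.rot.symm e))).symm := by
  refine ⟨by rw [C.crossed_symm]; exact h.not_crossed_symm_rot_symm_rot_symm_rot, Or.inl ?_⟩
  have k : C.rot (C.rot.symm (C.rot.symm (C.rot.symm e))) = C.rot.symm (C.rot.symm e) := by simp
  rw [symm_rot_symm_rot_symm (by rw [k]; exact h.tri_symm_rot_symm_rot)
    (by rw [k]; exact h.crossed_symm_rot_symm_rot), C.crossed_turn, k]
  exact h.crossed_symm_rot_symm_rot

end Bad

lemma Bad.unique {e d : G.Dart} (h : C.Bad e) (h' : C.Bad d) (hd : d.fst = e.fst) : d = e := by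
  by_contra hde
  exact h.not_full d hd hde h'.full

end Finite
end CrossedRotation
end PermOrbit

namespace PermOrbit

open Equiv

open Classical in
/-- The truth value of a proposition as an integer. -/
noncomputable def truth (p : Prop) : ℤ := if p then 1 else 0

lemma truth_of {p : Prop} (h : p) : truth p = 1 := if_pos h

lemma truth_of_not {p : Prop} (h : ¬ p) : truth p = 0 := if_neg h

lemma truth_nonneg (p : Prop) : 0 ≤ truth p := by unfold truth; split_ifs <;> norm_num

lemma truth_le_one (p : Prop) : truth p ≤ 1 := by unfold truth; split_ifs <;> norm_num

lemma truth_mono {p q : Prop} (h : p → q) : truth p ≤ truth q := by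
  by_cases hp : p
  · rw [truth_of hp, truth_of (h hp)]
  · rw [truth_of_not hp]; exact truth_nonneg q

lemma truth_add_truth_le_one {p q : Prop} (h : p → ¬ q) : truth p + truth q ≤ 1 := by
  by_cases hp : p
  · rw [truth_of_not (h hp), add_zero]; exact truth_le_one p
  · rw [truth_of_not hp, zero_add]; exact truth_le_one q

/-- No edge with ends of degree `7` lies in two triangles whose third vertices have degree at
most `9`. -/
def NoLightPair {V : Type*} [Fintype V] (G : SimpleGraph V) [DecidableRel G.Adj] : Prop :=
  ∀ x y a b, G.Adj x y → G.degree x = 7 → G.degree y = 7 → G.Adj x a → G.Adj y a → G.Adj x b →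
    G.Adj y b → a ≠ b → 10 ≤ G.degree a ∨ 10 ≤ G.degree b

/-- Whether the head of a dart has degree at least `10`. -/
noncomputable def heavy {V : Type*} [Fintype V] {G : SimpleGraph V} [DecidableRel G.Adj]
    (d : G.Dart) : ℤ := truth (10 ≤ G.degree d.snd)

namespace CrossedRotation
variable {V : Type*} {G : SimpleGraph V} {C : CrossedRotation G}

lemma snd_ne {d e : G.Dart} (h : d.fst = e.fst) (h' : d ≠ e) : d.snd ≠ e.snd :=
  fun k => h' (eq_of_ends h k)

variable [Fintype V] [DecidableRel G.Adj]

variable (C) in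
/-- The number of heavy heads among the uncrossed darts at the tail of a bad dart. -/
noncomputable def heavyCount (e : G.Dart) : ℤ :=
  heavy e + heavy (C.rot.symm e) + heavy (C.rot (C.rot e)) +
    heavy (C.rot.symm (C.rot.symm (C.rot.symm e)))

variable (C) in
/-- What a bad vertex has to get from its full triangle. -/
noncomputable def need (e : G.Dart) : ℤ := truth (C.Bad e) * max 0 (2 - C.heavyCount e)

lemma heavyCount_nonneg (e : G.Dart) : 0 ≤ C.heavyCount e := by
  unfold heavyCount heavy
  linarith [truth_nonneg (10 ≤ G.degree e.snd), truth_nonneg (10 ≤ G.degree (C.rot.symm e).snd),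
    truth_nonneg (10 ≤ G.degree (C.rot (C.rot e)).snd),
    truth_nonneg (10 ≤ G.degree (C.rot.symm (C.rot.symm (C.rot.symm e))).snd)]

lemma need_of_bad {e : G.Dart} (h : C.Bad e) : C.need e = max 0 (2 - C.heavyCount e) := by
  rw [need, truth_of h, one_mul]

lemma need_of_not_bad {e : G.Dart} (h : ¬ C.Bad e) : C.need e = 0 := by
  rw [need, truth_of_not h, zero_mul]

lemma need_le_two (e : G.Dart) : C.need e ≤ 2 := by
  by_cases h : C.Bad e
  · rw [need_of_bad h]
    have := heavyCount_nonneg (C := C) e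
    omega
  · rw [need_of_not_bad h]; norm_num

lemma bad_of_need {e : G.Dart} (h : 1 ≤ C.need e) : C.Bad e := by
  by_contra h'
  rw [need_of_not_bad h'] at h
  omega

namespace Bad
variable {e : G.Dart} (h : C.Bad e)
include h

lemma ne_symm_rot_symm_rot_symm_rot : e ≠ C.rot.symm (C.rot.symm (C.rot.symm e)) := by
  intro h'
  refine h.rot_rot_rot_ne ?_
  nth_rw 1 [h']
  simp

lemma one_le_of_degree_symm_rot (H : NoLightPair G) (hd : G.degree (C.rot.symm e).snd = 7) :
    1 ≤ heavy e + heavy (C.rot.symm (C.rot.symm (C.rot.symm e))) := by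
  have h1 : G.Adj e.fst (C.rot.symm e).snd := by
    rw [← C.rot_symm_fst e]; exact (C.rot.symm e).adj
  have hf : (C.rot.symm (C.rot.symm (C.rot.symm e))).fst = e.fst := by simp only [C.rot_symm_fst]
  have h2 : G.Adj e.fst (C.rot.symm (C.rot.symm (C.rot.symm e))).snd := by
    nth_rw 1 [← hf]; exact (C.rot.symm (C.rot.symm (C.rot.symm e))).adj
  have := H _ _ _ _ h1 h.degree hd e.adj h.adj_snd_snd_symm_rot.symm h2 h.adj_snd_symm_rot.symm
    (snd_ne hf.symm h.ne_symm_rot_symm_rot_symm_rot)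
  unfold heavy
  rcases this with h' | h'
  · rw [truth_of h']; linarith [truth_nonneg (10 ≤ G.degree (C.rot.symm (C.rot.symm (C.rot.symm e))).snd)]
  · rw [truth_of h']; linarith [truth_nonneg (10 ≤ G.degree e.snd)]

lemma one_le_of_degree_snd (H : NoLightPair G) (hd : G.degree e.snd = 7) :
    1 ≤ heavy (C.rot.symm e) + heavy (C.rot (C.rot e)) := by
  have h1 : G.Adj e.fst (C.rot.symm e).snd := by
    rw [← C.rot_symm_fst e]; exact (C.rot.symm e).adj
  have hf : (C.rot (C.rot e)).fst = e.fst := by simp only [C.rot_fst]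
  have h2 : G.Adj e.fst (C.rot (C.rot e)).snd := by
    nth_rw 1 [← hf]; exact (C.rot (C.rot e)).adj
  have hne : C.rot.symm e ≠ C.rot (C.rot e) := by
    rw [Ne, Equiv.symm_apply_eq]
    exact h.rot_rot_rot_ne.symm
  have := H _ _ _ _ e.adj h.degree hd h1 h.adj_snd_snd_symm_rot h2 h.adj_snd_snd_rot_rot
    (snd_ne ((C.rot_symm_fst e).trans hf.symm) hne)
  unfold heavy
  rcases this with h' | h'
  · rw [truth_of h']; linarith [truth_nonneg (10 ≤ G.degree (C.rot (C.rot e)).snd)]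
  · rw [truth_of h']; linarith [truth_nonneg (10 ≤ G.degree (C.rot.symm e).snd)]

end Bad

lemma need_le (H : NoLightPair G) (e : G.Dart) :
    C.need e ≤ 2 - truth (G.degree e.snd = 7) - truth (G.degree (C.rot.symm e).snd = 7) := by
  by_cases h : C.Bad e
  · have n1 := truth_nonneg (10 ≤ G.degree e.snd)
    have n2 := truth_nonneg (10 ≤ G.degree (C.rot.symm e).snd)
    have n3 := truth_nonneg (10 ≤ G.degree (C.rot (C.rot e)).snd)
    have n4 := truth_nonneg (10 ≤ G.degree (C.rot.symm (C.rot.symm (C.rot.symm e))).snd)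
    have k1 := h.one_le_of_degree_snd H
    have k2 := h.one_le_of_degree_symm_rot H
    rw [need_of_bad h]
    unfold heavyCount
    unfold heavy at *
    by_cases h1 : G.degree e.snd = 7 <;> by_cases h2 : G.degree (C.rot.symm e).snd = 7 <;>
      simp only [h1, h2, truth_of, truth_of_not, not_false_eq_true, forall_const] at * <;> omega
  · rw [need_of_not_bad h]
    linarith [truth_le_one (G.degree e.snd = 7), truth_le_one (G.degree (C.rot.symm e).snd = 7)]

variable (C) in
/-- The full triangle at `e` cannot pay for its two bad vertices on its own. -/
def Short (e : G.Dart) : Prop :=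
  8 ≤ G.degree e.snd ∧ 1 ≤ C.need e ∧ 1 ≤ C.need (C.rot.symm e).symm

lemma need_add_need_add_need_le (H : NoLightPair G) (hdeg : ∀ v, 7 ≤ G.degree v) {e : G.Dart}
    (h : C.Full e) :
    C.need e + C.need (C.rot e.symm) + C.need (C.rot.symm e).symm ≤
      truth (8 ≤ G.degree e.fst) + truth (8 ≤ G.degree (C.rot e.symm).fst) +
      truth (8 ≤ G.degree (C.rot.symm e).symm.fst) +
      (truth (C.Short e) + truth (C.Short (C.rot e.symm)) + truth (C.Short (C.rot.symm e).symm)) := by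
  have e1 : (C.rot e.symm).fst = e.snd := C.rot_fst _
  have e2 : (C.rot e.symm).snd = (C.rot.symm e).snd := by
    have := congrArg (fun d => d.fst) h.rot_rot_symm
    rw [C.rot_fst] at this
    exact this
  have e3 : (C.rot.symm e).symm.fst = (C.rot.symm e).snd := rfl
  have e4 : (C.rot.symm e).symm.snd = e.fst := C.rot_symm_fst e
  have p1 : C.rot.symm (C.rot e.symm) = e.symm := by simp
  have p2 : C.rot.symm (C.rot.symm e).symm = (C.rot e.symm).symm := by
    rw [← h.rot_rot_symm, Equiv.symm_apply_apply]
  have n0 := need_le_two (C := C) e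
  have n1 := need_le (C := C) H e
  have n2 := need_le (C := C) H (C.rot e.symm)
  have n3 := need_le (C := C) H (C.rot.symm e).symm
  have q1 : 1 ≤ C.need e → G.degree e.fst = 7 := fun k => (bad_of_need k).degree
  have q2 : 1 ≤ C.need (C.rot e.symm) → G.degree e.snd = 7 := fun k => by
    rw [← e1]; exact (bad_of_need k).degree
  have q3 : 1 ≤ C.need (C.rot.symm e).symm → G.degree (C.rot.symm e).snd = 7 := fun k =>
    (bad_of_need k).degree
  have s1 := truth_nonneg (C.Short e)
  have s2 := truth_nonneg (C.Short (C.rot e.symm))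
  have s3 := truth_nonneg (C.Short (C.rot.symm e).symm)
  have t1 : 8 ≤ G.degree e.snd → 1 ≤ C.need e → 1 ≤ C.need (C.rot.symm e).symm →
      truth (C.Short e) = 1 := fun a b c => truth_of ⟨a, b, c⟩
  have t2 : 8 ≤ G.degree (C.rot.symm e).snd → 1 ≤ C.need (C.rot e.symm) → 1 ≤ C.need e →
      truth (C.Short (C.rot e.symm)) = 1 := fun a b c => truth_of ⟨by rwa [e2], b, by
        rwa [p1, SimpleGraph.Dart.symm_symm]⟩
  have t3 : 8 ≤ G.degree e.fst → 1 ≤ C.need (C.rot.symm e).symm → 1 ≤ C.need (C.rot e.symm) →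
      truth (C.Short (C.rot.symm e).symm) = 1 := fun a b c => truth_of ⟨by rwa [e4], b, by
        rwa [p2, SimpleGraph.Dart.symm_symm]⟩
  have d1 := hdeg e.fst
  have d2 := hdeg e.snd
  have d3 := hdeg (C.rot.symm e).snd
  rw [e2, p1, show e.symm.snd = e.fst from rfl] at n2
  rw [e4, p2, show (C.rot e.symm).symm.snd = (C.rot e.symm).fst from rfl, e1] at n3
  rw [e1, e3]
  have c : ∀ n, 7 ≤ n → (n = 7 ∧ truth (n = 7) = 1 ∧ truth (8 ≤ n) = 0) ∨
      (8 ≤ n ∧ truth (n = 7) = 0 ∧ truth (8 ≤ n) = 1) := by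
    intro n hn
    rcases hn.eq_or_lt with rfl | hn
    · exact Or.inl ⟨rfl, truth_of rfl, truth_of_not (by omega)⟩
    · exact Or.inr ⟨hn, truth_of_not (by omega), truth_of hn⟩
  have c1 := c _ d1
  have c2 := c _ d2
  have c3 := c _ d3
  omega

lemma Short.spec (H : NoLightPair G) {e : G.Dart} (h : C.Short e) :
    10 ≤ G.degree (C.rot (C.rot.symm (C.rot.symm e)).symm).fst ∧
    (C.Tri (C.rot (C.rot.symm (C.rot.symm e)).symm) →
      C.Slot (C.rot (C.rot.symm (C.rot.symm e)).symm) ∧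
      10 ≤ G.degree (C.rot (C.rot.symm (C.rot.symm e)).symm).snd) := by
  obtain ⟨-, hn, hn'⟩ := h
  have hb := bad_of_need hn
  have hb' := bad_of_need hn'
  rw [need_of_bad hb] at hn
  rw [need_of_bad hb'] at hn'
  have hd7 : G.degree (C.rot.symm e).snd = 7 := hb'.degree
  set f := C.rot.symm e with hf
  set k := C.rot.symm f with hk
  set l := C.rot.symm k with hl
  have hkf : C.rot k = f := by simp [hk]
  have htk : C.Tri k := hb.tri_symm_rot_symm_rot
  have htf : C.Tri f := hb.tri_symm_rot
  have hck : C.crossed k := hb.crossed_symm_rot_symm_rot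
  have p1 : C.rot.symm f.symm = (C.rot e.symm).symm := by
    rw [hf, ← hb.full.rot_rot_symm, Equiv.symm_apply_apply]
  have p1s : (C.rot.symm f.symm).snd = e.snd := by
    rw [p1]; exact C.rot_fst _
  have ht : C.turn (C.rot f.symm) = k := by
    have := (not_crossed_symm_rot hb'.tri_rot hb'.crossed_rot).2
    rw [Equiv.symm_apply_apply, SimpleGraph.Dart.symm_symm] at this
    rw [hk, Equiv.eq_symm_apply]
    exact this
  have hz : k.snd = (C.rot (C.rot f.symm)).snd := by
    rw [← ht]; exact (turn_turn hb'.tri_rot hb'.tri_rot_rot hb'.crossed_rot).2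
  have hff : f.fst = e.fst := C.rot_symm_fst e
  have hkfst : k.fst = e.fst := (C.rot_symm_fst f).trans hff
  have hlfst : l.fst = e.fst := (C.rot_symm_fst k).trans hkfst
  have a1 : G.Adj e.fst f.snd := by rw [← hff]; exact f.adj
  have a2 : G.Adj f.snd e.snd := hb.adj_snd_snd_symm_rot.symm
  have a3 : G.Adj e.fst l.snd := by rw [← hlfst]; exact l.adj
  have a4 : G.Adj f.snd l.snd := hb.adj_snd_symm_rot.symm
  have a5 : G.Adj e.fst k.snd := by rw [← hkfst]; exact k.adj
  have a6 : G.Adj f.snd k.snd := by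
    rw [hz, show f.snd = (C.rot (C.rot f.symm)).fst by simp only [C.rot_fst]; rfl]
    exact (C.rot (C.rot f.symm)).adj
  have n1 : e.snd ≠ l.snd := snd_ne hlfst.symm hb.ne_symm_rot_symm_rot_symm_rot
  have n2 : k.snd ≠ e.snd := snd_ne hkfst fun h => hb.full.2.1 (h ▸ hck)
  have n3 : k.snd ≠ l.snd := snd_ne (hkfst.trans hlfst.symm) fun h =>
    hb.not_crossed_symm_rot_symm_rot_symm_rot (show C.crossed l from h ▸ hck)
  have H1 := H _ _ _ _ a1 hb.degree hd7 e.adj a2 a3 a4 n1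
  have H2 := H _ _ _ _ a1 hb.degree hd7 a5 a6 e.adj a2 n2
  have H3 := H _ _ _ _ a1 hb.degree hd7 a5 a6 a3 a4 n3
  have hkey : 10 ≤ G.degree l.snd ∧ 10 ≤ G.degree k.snd := by
    by_cases h1 : 10 ≤ G.degree e.snd
    · exfalso
      have m1 : heavy e = 1 := truth_of h1
      have m2 : heavy (C.rot.symm f.symm) = 1 := by
        unfold heavy
        rw [p1s]
        exact truth_of h1
      change 1 ≤ max 0 (2 - (heavy e + heavy f + heavy (C.rot (C.rot e)) + heavy l)) at hn
      unfold heavyCount at hn'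
      rcases H3 with h2 | h2
      · have m3 : heavy (C.rot (C.rot f.symm)) = 1 := by
          unfold heavy
          rw [← hz]
          exact truth_of h2
        have r1 : 0 ≤ heavy f.symm := truth_nonneg _
        have r2 : 0 ≤ heavy (C.rot.symm (C.rot.symm (C.rot.symm f.symm))) := truth_nonneg _
        omega
      · have m3 : heavy l = 1 := truth_of h2
        have r1 : 0 ≤ heavy f := truth_nonneg _
        have r2 : 0 ≤ heavy (C.rot (C.rot e)) := truth_nonneg _
        omega
    · exact ⟨H1.resolve_left h1, H2.resolve_right h1⟩
  refine ⟨?_, fun hT => ?_⟩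
  · rw [C.rot_fst]; exact hkey.2
  · have hck' : C.crossed k.symm := (C.crossed_symm k).2 hck
    obtain ⟨g1, g2, g3⟩ := not_crossed_rot hT hck'
    refine ⟨⟨g1, Or.inl (by rwa [Equiv.symm_apply_apply])⟩, ?_⟩
    have g4 := (turn_turn htk (by rwa [hkf]) hck).1
    have g5 : C.rot (C.rot k.symm).symm = C.turn k := C.turn.injective (g3.trans g4.symm)
    have g6 := congrArg (fun d => d.fst) g5
    rw [C.rot_fst, turn_fst_eq htk hck] at g6
    change (C.rot k.symm).snd = l.snd at g6
    rw [g6]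
    exact hkey.1

end CrossedRotation
end PermOrbit

namespace PermOrbit

open Equiv

namespace CrossedRotation
variable {V : Type*} {G : SimpleGraph V} {C : CrossedRotation G}

lemma weight_eq (e : G.Dart) : C.weight e = truth (C.Full e) + 3 * truth (¬ C.Tri e) := by
  by_cases h : C.Tri e
  · rw [truth_of_not (not_not_intro h)]
    by_cases h' : C.Full e
    · rw [weight_of_full h', truth_of h', mul_zero, add_zero]
    · rw [weight_of_tri h h', truth_of_not h', mul_zero, add_zero]
  · rw [weight_of_not_tri h, truth_of h, truth_of_not fun h' => h h'.1]
    norm_num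

lemma truth_full_of_tri {e : G.Dart} (h : C.Tri e) :
    truth (C.Full e) = 1 - truth (C.crossed e) - truth (C.crossed (C.rot.symm e)) := by
  rcases h.cases with h' | h' | h'
  · rw [truth_of ⟨h, h'.1, h'.2.1⟩, truth_of_not h'.1, truth_of_not h'.2.1]; norm_num
  · rw [truth_of_not fun k => k.2.1 h'.1, truth_of h'.1, truth_of_not h'.2.1]; norm_num
  · rw [truth_of_not fun k => k.2.2 h'.2.1, truth_of_not h'.1, truth_of h'.2.1]; norm_num

variable [Fintype V] [DecidableRel G.Adj]

variable (C) in
/-- What a dart needs for its bad tail, minus what its tail of large degree can give. -/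
noncomputable def gain (e : G.Dart) : ℤ :=
  2 * truth (C.Bad e) - truth (C.Full e ∧ 8 ≤ G.degree e.fst) -
    truth (¬ C.Tri e ∧ 10 ≤ G.degree e.fst) - truth (C.Slot e ∧ 10 ≤ G.degree e.fst)

section Vertex
variable [DecidableEq V]

variable (C) in
lemma sum_rot (v : V) (f : G.Dart → ℤ) :
    ∑ e with e.fst = v, f (C.rot e) = ∑ e with e.fst = v, f e :=
  Finset.sum_equiv C.rot (by simp [C.rot_fst]) fun _ _ => rfl

variable (C) in
lemma sum_symm_rot (v : V) (f : G.Dart → ℤ) :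
    ∑ e with e.fst = v, f (C.rot.symm e) = ∑ e with e.fst = v, f e :=
  Finset.sum_equiv C.rot.symm (by simp [C.rot_symm_fst]) fun _ _ => rfl

lemma sum_one (v : V) : ∑ e : G.Dart with e.fst = v, (1 : ℤ) = G.degree v := by
  rw [Finset.sum_const, nsmul_one, ← G.dart_fst_fiber_card_eq_degree v]

lemma vertex_le_of_degree_eq_seven {v : V} (hv : G.degree v = 7) :
    3 * (8 - (G.degree v : ℤ)) ≤
      ∑ e : G.Dart with e.fst = v, (C.weight e + 2 * truth (C.Bad e)) := by
  set s : Finset G.Dart := {e | e.fst = v} with hs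
  have hmem : ∀ {e : G.Dart}, e ∈ s ↔ e.fst = v := by simp [hs]
  have hn : ∀ e ∈ s, 0 ≤ C.weight e + 2 * truth (C.Bad e) := fun e _ => by
    rw [weight_eq]
    linarith [truth_nonneg (C.Bad e), truth_nonneg (C.Full e), truth_nonneg (¬ C.Tri e)]
  have hle := fun e (he : e ∈ s) => Finset.single_le_sum hn he
  rw [hv]
  by_cases hT : ∀ e ∈ s, C.Tri e
  · by_cases hB : ∃ e ∈ s, C.Bad e
    · obtain ⟨e, he, hb⟩ := hB
      have := hle e he
      rw [weight_of_full hb.full, truth_of hb] at this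
      exact this
    push Not at hB
    have hw : ∑ e ∈ s, (C.weight e + 2 * truth (C.Bad e)) = ∑ e ∈ s, truth (C.Full e) :=
      Finset.sum_congr rfl fun e he => by
        rw [weight_eq, truth_of_not (hB e he), truth_of_not (not_not_intro (hT e he))]
        norm_num
    have hodd : ∑ e ∈ s, truth (C.Full e) = 7 - 2 * ∑ e ∈ s, truth (C.crossed e) := by
      rw [Finset.sum_congr rfl fun e he => truth_full_of_tri (hT e he), Finset.sum_sub_distrib,
        Finset.sum_sub_distrib, sum_symm_rot C v fun e => truth (C.crossed e), sum_one, hv]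
      push_cast
      ring
    rw [hw]
    obtain ⟨e, he, hf⟩ : ∃ e ∈ s, C.Full e := by
      by_contra! h
      rw [Finset.sum_eq_zero fun e he => truth_of_not (h e he)] at hodd
      omega
    obtain ⟨d, hd, hde, hf'⟩ : ∃ d ∈ s, d ≠ e ∧ C.Full d := by
      by_contra! h
      have he' := hmem.1 he
      exact hB e he ⟨by rw [he', hv], hf, fun d hd => hT d (hmem.2 (hd.trans he')),
        fun d hd => h d (hmem.2 (hd.trans he'))⟩
    have h2 : 2 ≤ ∑ e ∈ s, truth (C.Full e) := by
      calc (2 : ℤ) = ∑ e ∈ {d, e}, truth (C.Full e) := by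
            rw [Finset.sum_pair hde, truth_of hf, truth_of hf']; norm_num
        _ ≤ _ := Finset.sum_le_sum_of_subset_of_nonneg
            (by simp [Finset.insert_subset_iff, hd, he]) fun _ _ _ => truth_nonneg _
    omega
  · push Not at hT
    obtain ⟨e, he, ht⟩ := hT
    have := hle e he
    rw [weight_of_not_tri ht] at this
    push_cast
    linarith [truth_nonneg (C.Bad e)]

variable (C) in
lemma three_mul_sum_slot_le (v : V) :
    3 * ∑ e : G.Dart with e.fst = v, truth (C.Slot e) ≤ 2 * G.degree v := by
  have h1 : ∑ e : G.Dart with e.fst = v, truth (C.Slot e) ≤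
      G.degree v - ∑ e : G.Dart with e.fst = v, truth (C.crossed e) := by
    rw [← sum_one, ← Finset.sum_sub_distrib]
    refine Finset.sum_le_sum fun e _ => ?_
    by_cases h : C.Slot e
    · rw [truth_of h, truth_of_not h.1]; norm_num
    · rw [truth_of_not h]; linarith [truth_le_one (C.crossed e)]
  have h2 : ∑ e : G.Dart with e.fst = v, truth (C.Slot e) ≤
      2 * ∑ e : G.Dart with e.fst = v, truth (C.crossed e) := by
    rw [two_mul]
    nth_rw 2 [← sum_symm_rot C v]
    nth_rw 3 [← sum_rot C v]
    rw [← Finset.sum_add_distrib]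
    refine Finset.sum_le_sum fun e _ => ?_
    have k1 := truth_nonneg (C.crossed (C.rot.symm e))
    have k2 := truth_nonneg (C.crossed (C.rot e))
    by_cases h : C.Slot e
    · rw [truth_of h]
      rcases h.2 with h' | h' <;> rw [truth_of h'] <;> linarith
    · rw [truth_of_not h]; linarith
  linarith

lemma vertex_le {v : V} (hv : 7 ≤ G.degree v) :
    3 * (8 - (G.degree v : ℤ)) - ∑ e : G.Dart with e.fst = v, C.weight e ≤
      ∑ e : G.Dart with e.fst = v, C.gain e := by
  rw [sub_le_iff_le_add', ← Finset.sum_add_distrib]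
  rcases hv.eq_or_lt with h7 | h8
  · refine (vertex_le_of_degree_eq_seven (C := C) h7.symm).trans
      (Finset.sum_le_sum fun e he => ?_)
    have he' : G.degree e.fst = 7 := by rw [(Finset.mem_filter.1 he).2, ← h7]
    rw [gain, truth_of_not (p := C.Full e ∧ _) (by omega),
      truth_of_not (p := ¬ C.Tri e ∧ _) (by omega), truth_of_not (p := C.Slot e ∧ _) (by omega)]
    linarith
  by_cases h10 : 10 ≤ G.degree v
  · have hs := three_mul_sum_slot_le C v
    have : -∑ e : G.Dart with e.fst = v, truth (C.Slot e) ≤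
        ∑ e : G.Dart with e.fst = v, (C.weight e + C.gain e) := by
      rw [← Finset.sum_neg_distrib]
      refine Finset.sum_le_sum fun e _ => ?_
      rw [weight_eq, gain]
      linarith [truth_nonneg (C.Bad e), truth_nonneg (¬ C.Tri e),
        truth_mono (p := C.Full e ∧ 8 ≤ G.degree e.fst) And.left,
        truth_mono (p := ¬ C.Tri e ∧ 10 ≤ G.degree e.fst) And.left,
        truth_mono (p := C.Slot e ∧ 10 ≤ G.degree e.fst) And.left]
    omega
  · have : 0 ≤ ∑ e : G.Dart with e.fst = v, (C.weight e + C.gain e) := by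
      refine Finset.sum_nonneg fun e he => ?_
      have he' := (Finset.mem_filter.1 he).2
      rw [weight_eq, gain, truth_of_not (p := ¬ C.Tri e ∧ _) (by rw [he']; exact fun h => h10 h.2),
        truth_of_not (p := C.Slot e ∧ _) (by rw [he']; exact fun h => h10 h.2)]
      linarith [truth_nonneg (C.Bad e), truth_nonneg (¬ C.Tri e),
        truth_mono (p := C.Full e ∧ 8 ≤ G.degree e.fst) And.left]
    omega

end Vertex

lemma euler_le_sum_gain [Nonempty G.Dart] (hdeg : ∀ v, 7 ≤ G.degree v) :
    48 ≤ ∑ e, C.gain e := by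
  classical
  have h := C.euler_le hdeg
  have h' := Finset.sum_le_sum fun v (_ : v ∈ Finset.univ) => vertex_le (C := C) (hdeg v)
  rw [Finset.sum_sub_distrib, Finset.sum_fiberwise Finset.univ fun e : G.Dart => e.fst,
    Finset.sum_fiberwise Finset.univ fun e : G.Dart => e.fst] at h'
  exact h.trans h'

variable (C) in
lemma sum_heavyCount_le :
    ∑ e, truth (C.Bad e) * C.heavyCount e ≤
      ∑ e : G.Dart, truth (C.Slot e ∧ 10 ≤ G.degree e.fst ∧ G.degree e.snd = 7) := by
  let τ : Perm G.Dart := SimpleGraph.Dart.symm_involutive.toPerm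
  have hsum : ∑ e, truth (C.Bad e) * C.heavyCount e = ∑ g : G.Dart, (truth (C.Bad g) * heavy g +
      truth (C.Bad (C.rot g)) * heavy g + truth (C.Bad (C.rot.symm (C.rot.symm g))) * heavy g +
      truth (C.Bad (C.rot (C.rot (C.rot g)))) * heavy g) := by
    simp only [heavyCount, mul_add, Finset.sum_add_distrib]
    congr 1
    · congr 1
      · congr 1
        refine (Equiv.sum_comp C.rot _).symm.trans ?_
        simp
      · refine (Equiv.sum_comp (C.rot.symm.trans C.rot.symm) _).symm.trans ?_
        simp
    · refine (Equiv.sum_comp (C.rot.trans (C.rot.trans C.rot)) _).symm.trans ?_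
      simp
  rw [hsum, ← Equiv.sum_comp τ fun e : G.Dart =>
    truth (C.Slot e ∧ 10 ≤ G.degree e.fst ∧ G.degree e.snd = 7)]
  refine Finset.sum_le_sum fun g _ => ?_
  change _ ≤ truth (C.Slot g.symm ∧ 10 ≤ G.degree g.snd ∧ G.degree g.fst = 7)
  by_cases hh : 10 ≤ G.degree g.snd
  swap
  · rw [heavy, truth_of_not hh]
    simpa using truth_nonneg _
  rw [heavy, truth_of hh]
  have hr := C.rot_fst
  have hr' := C.rot_symm_fst
  have f1 : C.Bad g → C.Slot g.symm ∧ 10 ≤ G.degree g.snd ∧ G.degree g.fst = 7 :=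
    fun h => ⟨h.slot_symm, hh, h.degree⟩
  have f2 : C.Bad (C.rot g) → C.Slot g.symm ∧ 10 ≤ G.degree g.snd ∧ G.degree g.fst = 7 :=
    fun h => ⟨by simpa using h.slot_symm_rot_symm, hh, by have := h.degree; rwa [hr] at this⟩
  have f3 : C.Bad (C.rot.symm (C.rot.symm g)) →
      C.Slot g.symm ∧ 10 ≤ G.degree g.snd ∧ G.degree g.fst = 7 :=
    fun h => ⟨by simpa using h.slot_rot_rot_symm, hh, by have := h.degree; rwa [hr', hr'] at this⟩
  have f4 : C.Bad (C.rot (C.rot (C.rot g))) →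
      C.Slot g.symm ∧ 10 ≤ G.degree g.snd ∧ G.degree g.fst = 7 :=
    fun h => ⟨by simpa using h.slot_symm_rot_symm_rot_symm_rot_symm, hh,
      by have := h.degree; rwa [hr, hr, hr] at this⟩
  have p12 : C.Bad g → ¬ C.Bad (C.rot g) := fun h h' => h.rot_ne (h.unique h' (by simp only [hr]))
  have p13 : C.Bad g → ¬ C.Bad (C.rot.symm (C.rot.symm g)) := fun h h' => by
    have := congrArg (fun d => C.rot (C.rot d)) (h.unique h' (by simp only [hr']))
    exact h.rot_rot_ne (by simpa using this.symm)
  have p14 : C.Bad g → ¬ C.Bad (C.rot (C.rot (C.rot g))) := fun h h' =>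
    h.rot_rot_rot_ne (h.unique h' (by simp only [hr]))
  have p23 : C.Bad (C.rot g) → ¬ C.Bad (C.rot.symm (C.rot.symm g)) := fun h h' =>
    h'.rot_rot_rot_ne (by simpa using h'.unique h (by simp only [hr, hr']))
  have p24 : C.Bad (C.rot g) → ¬ C.Bad (C.rot (C.rot (C.rot g))) := fun h h' =>
    h.rot_rot_ne (h.unique h' (by simp only [hr]))
  have p34 : C.Bad (C.rot.symm (C.rot.symm g)) → ¬ C.Bad (C.rot (C.rot (C.rot g))) :=
    fun h h' => h.iterate_five_rot_ne (by simpa using h.unique h' (by simp only [hr, hr']))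
  have t1 := truth_mono f1
  have t2 := truth_mono f2
  have t3 := truth_mono f3
  have t4 := truth_mono f4
  have q12 := truth_add_truth_le_one p12
  have q13 := truth_add_truth_le_one p13
  have q14 := truth_add_truth_le_one p14
  have q23 := truth_add_truth_le_one p23
  have q24 := truth_add_truth_le_one p24
  have q34 := truth_add_truth_le_one p34
  have n1 := truth_nonneg (C.Bad g)
  have n2 := truth_nonneg (C.Bad (C.rot g))
  have n3 := truth_nonneg (C.Bad (C.rot.symm (C.rot.symm g)))
  have n4 := truth_nonneg (C.Bad (C.rot (C.rot (C.rot g))))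
  omega

lemma sum_need_le (H : NoLightPair G) (hdeg : ∀ v, 7 ≤ G.degree v) :
    ∑ e, C.need e ≤ ∑ e : G.Dart, truth (C.Full e ∧ 8 ≤ G.degree e.fst) +
      ∑ e, truth (C.Short e) := by
  let τ : Perm G.Dart := SimpleGraph.Dart.symm_involutive.toPerm
  set N : G.Dart → ℤ := fun e : G.Dart =>
    C.need e - truth (C.Full e ∧ 8 ≤ G.degree e.fst) - truth (C.Short e) with hN
  have hfull : ∀ e : G.Dart, ¬ C.Full e → N e ≤ 0 := fun e h => by
    simp only [hN]
    rw [need_of_not_bad fun h' => h h'.full]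
    linarith [truth_nonneg (C.Full e ∧ 8 ≤ G.degree e.fst), truth_nonneg (C.Short e)]
  have h1 : ∑ e : G.Dart, N (C.rot e.symm) = ∑ e, N e := Equiv.sum_comp (τ.trans C.rot) N
  have h2 : ∑ e, N (C.rot.symm e).symm = ∑ e, N e := Equiv.sum_comp (C.rot.symm.trans τ) N
  have h3 : ∑ e : G.Dart, (N e + N (C.rot e.symm) + N (C.rot.symm e).symm) ≤ 0 := by
    refine Finset.sum_nonpos fun e _ => ?_
    by_cases h : C.Full e
    · have := need_add_need_add_need_le H hdeg h
      simp only [hN, h, h.rot_symm, h.symm_rot, true_and]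
      linarith
    · have k1 := hfull e h
      have k2 := hfull (C.rot e.symm) fun h' => h (by simpa using h'.symm_rot)
      have k3 := hfull (C.rot.symm e).symm fun h' => h (by simpa using h'.rot_symm)
      linarith
  rw [Finset.sum_add_distrib, Finset.sum_add_distrib, h1, h2] at h3
  simp only [hN, Finset.sum_sub_distrib] at h3
  linarith

lemma sum_short_le (H : NoLightPair G) :
    ∑ e, truth (C.Short e) ≤ ∑ e : G.Dart, (truth (¬ C.Tri e ∧ 10 ≤ G.degree e.fst) +
      truth (C.Slot e ∧ 10 ≤ G.degree e.fst ∧ 10 ≤ G.degree e.snd)) := by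
  let τ : Perm G.Dart := SimpleGraph.Dart.symm_involutive.toPerm
  rw [← Equiv.sum_comp (((C.rot.symm.trans C.rot.symm).trans τ).trans C.rot)
    fun e : G.Dart => _ + truth (C.Slot e ∧ _)]
  refine Finset.sum_le_sum fun e _ => ?_
  change _ ≤ truth (¬ C.Tri (C.rot (C.rot.symm (C.rot.symm e)).symm) ∧
      10 ≤ G.degree (C.rot (C.rot.symm (C.rot.symm e)).symm).fst) +
    truth (C.Slot (C.rot (C.rot.symm (C.rot.symm e)).symm) ∧
      10 ≤ G.degree (C.rot (C.rot.symm (C.rot.symm e)).symm).fst ∧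
      10 ≤ G.degree (C.rot (C.rot.symm (C.rot.symm e)).symm).snd)
  set g := C.rot (C.rot.symm (C.rot.symm e)).symm
  have n1 := truth_nonneg (¬ C.Tri g ∧ 10 ≤ G.degree g.fst)
  have n2 := truth_nonneg (C.Slot g ∧ 10 ≤ G.degree g.fst ∧ 10 ≤ G.degree g.snd)
  by_cases h : C.Short e
  · obtain ⟨k1, k2⟩ := h.spec H
    rw [truth_of h]
    by_cases hT : C.Tri g
    · rw [truth_of (p := C.Slot g ∧ _) ⟨(k2 hT).1, k1, (k2 hT).2⟩]
      linarith
    · rw [truth_of (p := ¬ C.Tri g ∧ _) ⟨hT, k1⟩]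
      linarith
  · rw [truth_of_not h]
    linarith

lemma sum_gain_nonpos (H : NoLightPair G) (hdeg : ∀ v, 7 ≤ G.degree v) :
    ∑ e, C.gain e ≤ 0 := by
  have h1 := sum_need_le (C := C) H hdeg
  have h2 := sum_short_le (C := C) H
  have h3 := sum_heavyCount_le C
  have h4 : ∑ e, (2 * truth (C.Bad e)) ≤
      ∑ e, C.need e + ∑ e, truth (C.Bad e) * C.heavyCount e := by
    rw [← Finset.sum_add_distrib]
    refine Finset.sum_le_sum fun e _ => ?_
    rw [need, ← mul_add, mul_comm]
    refine mul_le_mul_of_nonneg_left ?_ (truth_nonneg _)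
    linarith [le_max_right 0 (2 - C.heavyCount e)]
  have h5 : ∑ e : G.Dart, truth (C.Slot e ∧ 10 ≤ G.degree e.fst ∧ G.degree e.snd = 7) +
      ∑ e : G.Dart, truth (C.Slot e ∧ 10 ≤ G.degree e.fst ∧ 10 ≤ G.degree e.snd) ≤
      ∑ e : G.Dart, truth (C.Slot e ∧ 10 ≤ G.degree e.fst) := by
    rw [← Finset.sum_add_distrib]
    refine Finset.sum_le_sum fun e _ => ?_
    by_cases h : G.degree e.snd = 7
    · rw [truth_of_not (p := _ ∧ _ ∧ 10 ≤ G.degree e.snd) (by omega), add_zero]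
      exact truth_mono fun k => ⟨k.1, k.2.1⟩
    · rw [truth_of_not (p := _ ∧ _ ∧ G.degree e.snd = 7) (by omega), zero_add]
      exact truth_mono fun k => ⟨k.1, k.2.1⟩
  simp only [gain, Finset.sum_sub_distrib]
  rw [Finset.sum_add_distrib] at h2
  linarith

theorem not_noLightPair (C : CrossedRotation G) [Nonempty G.Dart] (hdeg : ∀ v, 7 ≤ G.degree v) :
    ¬ NoLightPair G := fun H => by
  have := (euler_le_sum_gain (C := C) hdeg).trans (sum_gain_nonpos H hdeg)
  omega

end CrossedRotation
end PermOrbit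

/-- Every 1-planar graph with minimum degree 7 contains a 4-cycle
x₁x₂x₃x₄ with chord x₁x₃ of type (7, 9⁻, 7, 9⁻). -/
theorem one_planar_light_chorded_4cycle {V : Type*} [Fintype V] [Nonempty V]
    (G : SimpleGraph V) [DecidableRel G.Adj] (h1p : G.IsOnePlanar)
    (hmin : ∀ v : V, 7 ≤ G.degree v) :
    ∃ x₁ x₂ x₃ x₄ : V, x₁ ≠ x₂ ∧ x₁ ≠ x₃ ∧ x₁ ≠ x₄ ∧ x₂ ≠ x₃ ∧ x₂ ≠ x₄ ∧ x₃ ≠ x₄ ∧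
      G.Adj x₁ x₂ ∧ G.Adj x₂ x₃ ∧ G.Adj x₃ x₄ ∧ G.Adj x₄ x₁ ∧ G.Adj x₁ x₃ ∧
      G.degree x₁ = 7 ∧ G.degree x₃ = 7 ∧ G.degree x₂ ≤ 9 ∧ G.degree x₄ ≤ 9 := by
  classical
  obtain ⟨P⟩ := h1p
  obtain ⟨C⟩ := PermOrbit.OnePlanarDrawing.exists_dartCurves P
  obtain ⟨R⟩ := C.exists_crossedRotation
  obtain ⟨v⟩ := ‹Nonempty V›
  obtain ⟨w, hw⟩ := (G.degree_pos_iff_exists_adj v).1 (by linarith [hmin v])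
  have : Nonempty G.Dart := ⟨⟨(v, w), hw⟩⟩
  have h := R.not_noLightPair hmin
  unfold PermOrbit.NoLightPair at h
  push Not at h
  obtain ⟨x, y, a, b, hxy, hx, hy, hxa, hya, hxb, hyb, hab, ha, hb⟩ := h
  exact ⟨x, a, y, b, hxa.ne, hxy.ne, hxb.ne, hya.ne', hab, hyb.ne, hxa, hya.symm, hyb, hxb.symm,
    hxy, hx, hy, by omega, by omega⟩
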